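/- arXiv:2105.00955 — 3 statements merged into one kernel-verified Lean document; each statement's English description precedes it below -/
import Mathlib

section
/- Let A be a unital alternative *-algebra over ℂ containing a nontrivial symmetric idempotent e satisfying conditions (♠) and (♣), and let Φ : A → A be a map satisfying the *-Jordan n-derivation identity in the last two slots. Then Φ is an additive *-derivation, i.e., Φ(a + b) = Φ(a) + Φ(b), Φ(ab) = Φ(a)b + aΦ(b), and Φ(a*) = Φ(a)* for all a, b ∈ A. -/
/-- The Jordan `•`-product `a • b = ab + b a*`. -/
def starJordan {A : Type*} [NonAssocRing A] [StarRing A] (a b : A) : A :=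
  a * b + b * star a

/-- Left-normed iterated Jordan `•`-product of a list (empty list ↦ 0, junk value). -/
def leftStarJordan {A : Type*} [NonAssocRing A] [StarRing A] : List A → A
  | [] => 0
  | x :: xs => xs.foldl starJordan x

/-- The family `a₁ = ⋯ = a_{n-2} = 1`, `a_{n-1} = x`, `a_n = y`. -/
def lastTwoFamily {A : Type*} [One A] (n : ℕ) (x y : A) : Fin n → A :=
  fun i => if (i : ℕ) = n - 2 then x else if (i : ℕ) = n - 1 then y else 1

/-- `e₁ = e`, `e₂ = 1 - e`. -/
def peirceIdem {A : Type*} [NonAssocRing A] (e : A) : Fin 2 → A :=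
  fun i => if i = 0 then e else 1 - e

/-- Membership in the Peirce component `A_{ij}`: `eᵢ x = x` and `x eⱼ = x`. -/
def inPeirce {A : Type*} [NonAssocRing A] (e : A) (i j : Fin 2) (x : A) : Prop :=
  peirceIdem e i * x = x ∧ x * peirceIdem e j = x

/-- The inner derivation `Ξ_{y,z}(a) = y(za) − z(ya) + y(az) − (ya)z + (az)y − (ay)z`. -/
def innerDer {A : Type*} [NonAssocRing A] (y z a : A) : A :=
  y * (z * a) - z * (y * a) + y * (a * z) - (y * a) * z + (a * z) * y - (a * y) * z

namespace StarJordan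

variable {A : Type*} [NonAssocRing A]

/-- The Peirce eigenspaces of an idempotent, indexed by integer eigenvalues. -/
structure IsPeirce (e : A) (i j : ℤ) (x : A) : Prop where
  left : e * x = i • x
  right : x * e = j • x

namespace IsPeirce

variable {e : A} {i j k l : ℤ} {x y : A}

protected theorem compl (hx : IsPeirce e i j x) : IsPeirce (1 - e) (1 - i) (1 - j) x where
  left := by rw [sub_mul, one_mul, hx.left]; module
  right := by rw [mul_sub, mul_one, hx.right]; module

protected theorem add (hx : IsPeirce e i j x) (hy : IsPeirce e i j y) : IsPeirce e i j (x + y) where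
  left := by rw [mul_add, hx.left, hy.left, smul_add]
  right := by rw [add_mul, hx.right, hy.right, smul_add]

protected theorem zsmul (m : ℤ) (hx : IsPeirce e i j x) : IsPeirce e i j (m • x) where
  left := by rw [mul_smul_comm, hx.left, smul_comm]
  right := by rw [smul_mul_assoc, hx.right, smul_comm]

theorem of_zsmul [IsAddTorsionFree A] {m : ℤ} (hm : m ≠ 0) (hx : IsPeirce e i j (m • x)) :
    IsPeirce e i j x where
  left := by
    have := hx.left
    rw [mul_smul_comm, smul_comm] at this
    exact zsmul_right_injective hm this
  right := by
    have := hx.right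
    rw [smul_mul_assoc, smul_comm] at this
    exact zsmul_right_injective hm this

end IsPeirce

/-- The defect of the Leibniz rule. -/
def leibnizDefect (D : A →+ A) (x y : A) : A := D (x * y) - D x * y - x * D y

theorem leibnizDefect_add_left (D : A →+ A) (x y z : A) :
    leibnizDefect D (x + y) z = leibnizDefect D x z + leibnizDefect D y z := by
  simp only [leibnizDefect, add_mul, map_add]; abel

theorem leibnizDefect_add_right (D : A →+ A) (x y z : A) :
    leibnizDefect D x (y + z) = leibnizDefect D x y + leibnizDefect D x z := by
  simp only [leibnizDefect, mul_add, map_add]; abel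

theorem leibnizDefect_zsmul_left (D : A →+ A) (m : ℤ) (x y : A) :
    leibnizDefect D (m • x) y = m • leibnizDefect D x y := by
  simp only [leibnizDefect, smul_mul_assoc, map_zsmul, smul_sub]

theorem leibnizDefect_zsmul_right (D : A →+ A) (m : ℤ) (x y : A) :
    leibnizDefect D x (m • y) = m • leibnizDefect D x y := by
  simp only [leibnizDefect, mul_smul_comm, map_zsmul, smul_sub]

theorem lastTwoFamily_last (m : ℕ) (x y : A) :
    lastTwoFamily (m + 3) x y (Fin.last _) = y := by
  simp [lastTwoFamily]

theorem lastTwoFamily_castSucc_last (m : ℕ) (x y : A) :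
    lastTwoFamily (m + 3) x y (Fin.last _).castSucc = x := by
  simp [lastTwoFamily]

theorem lastTwoFamily_castSucc_castSucc (m : ℕ) (x y : A) (i : Fin (m + 1)) :
    lastTwoFamily (m + 3) x y i.castSucc.castSucc = 1 := by
  have := i.isLt
  have h1 : (i : ℕ) ≠ m + 1 := by omega
  have h2 : (i : ℕ) ≠ m + 2 := by omega
  simp [lastTwoFamily, h1, h2]

variable [StarRing A]

theorem add_left (a b c : A) : starJordan (a + b) c = starJordan a c + starJordan b c := by
  simp only [starJordan, star_add, add_mul, mul_add]; abel

theorem add_right (a b c : A) : starJordan a (b + c) = starJordan a b + starJordan a c := by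
  simp only [starJordan, add_mul, mul_add]; abel

theorem zsmul_left (m : ℤ) (a b : A) : starJordan (m • a) b = m • starJordan a b := by
  simp only [starJordan, star_zsmul, smul_mul_assoc, mul_smul_comm, smul_add]

theorem sub_left (a b c : A) : starJordan (a - b) c = starJordan a c - starJordan b c := by
  simp only [starJordan, star_sub, sub_mul, mul_sub]; abel

theorem sub_right (a b c : A) : starJordan a (b - c) = starJordan a b - starJordan a c := by
  simp only [starJordan, sub_mul, mul_sub]; abel

/-- Alternative star rings with a symmetric idempotent `e` such that `x(·)e` and `x(·)(1 - e)`
determine `x`. -/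
structure FaithfulIdem (e : A) : Prop where
  alt_left : ∀ a b : A, a * a * b = a * (a * b)
  alt_right : ∀ a b : A, b * a * a = b * (a * a)
  star_eq : star e = e
  idem : e * e = e
  faithful : ∀ x : A, (∀ r : A, x * r * e = 0) → x = 0
  faithful_compl : ∀ x : A, (∀ r : A, x * r * (1 - e) = 0) → x = 0

namespace FaithfulIdem

variable {e : A}

theorem compl (h : FaithfulIdem e) : FaithfulIdem (1 - e) where
  alt_left := h.alt_left
  alt_right := h.alt_right
  star_eq := by rw [star_sub, star_one, h.star_eq]
  idem := by simp only [mul_sub, sub_mul, mul_one, one_mul, h.idem]; abel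
  faithful := h.faithful_compl
  faithful_compl := by simpa using h.faithful

theorem assoc_left (h : FaithfulIdem e) (a b c : A) :
    a * b * c - a * (b * c) + (b * a * c - b * (a * c)) = 0 := by
  have := h.alt_left (a + b) c
  simp only [add_mul, mul_add, h.alt_left] at this
  linear_combination (norm := module) this

theorem assoc_right (h : FaithfulIdem e) (a b c : A) :
    a * b * c - a * (b * c) + (a * c * b - a * (c * b)) = 0 := by
  have := h.alt_right (b + c) a
  simp only [add_mul, mul_add, h.alt_right] at this
  linear_combination (norm := module) this

theorem mul_mul_left (h : FaithfulIdem e) (a : A) : e * (e * a) = e * a := by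
  rw [← h.alt_left, h.idem]

theorem mul_mul_right (h : FaithfulIdem e) (a : A) : a * e * e = a * e := by
  rw [h.alt_right, h.idem]

theorem flexible (h : FaithfulIdem e) (a : A) : e * a * e = e * (a * e) := by
  have h1 := h.assoc_left e a e
  have h2 := h.assoc_right a e e
  rw [h.mul_mul_right, h.idem] at h2
  rw [h.mul_mul_right, h.idem] at h1
  linear_combination (norm := module) h1

theorem exists_decomp (h : FaithfulIdem e) (a : A) : ∃ a₁₁ a₁₀ a₀₁ a₀₀ : A,
    IsPeirce e 1 1 a₁₁ ∧ IsPeirce e 1 0 a₁₀ ∧ IsPeirce e 0 1 a₀₁ ∧ IsPeirce e 0 0 a₀₀ ∧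
      a = a₁₁ + (a₁₀ + a₀₁) + a₀₀ := by
  refine ⟨e * (a * e), e * a - e * (a * e), a * e - e * (a * e),
    a - e * a - a * e + e * (a * e), ⟨?_, ?_⟩, ⟨?_, ?_⟩, ⟨?_, ?_⟩, ⟨?_, ?_⟩, by abel⟩ <;>
  · simp only [mul_sub, sub_mul, mul_add, add_mul, h.mul_mul_left, h.flexible, h.mul_mul_right]
    module

end FaithfulIdem

namespace IsPeirce

variable {e : A} {i j k l : ℤ} {x y : A}

protected theorem star (h : FaithfulIdem e) (hx : IsPeirce e i j x) : IsPeirce e j i (star x) where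
  left := by rw [← star_zsmul, ← hx.right, star_mul, h.star_eq]
  right := by rw [← star_zsmul, ← hx.left, star_mul, h.star_eq]

protected theorem mul (h : FaithfulIdem e) (hx : IsPeirce e i j x) (hy : IsPeirce e k l y) :
    IsPeirce e (i + j - k) (k + l - j) (x * y) where
  left := by
    have := h.assoc_left e x y
    simp only [hx.left, hx.right, hy.left, smul_mul_assoc, mul_smul_comm] at this
    linear_combination (norm := module) -this
  right := by
    have := h.assoc_right x e y
    simp only [hx.right, hy.left, hy.right, smul_mul_assoc, mul_smul_comm] at this
    linear_combination (norm := module) this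

protected theorem idem (h : FaithfulIdem e) : IsPeirce e 1 1 e :=
  ⟨by rw [h.idem, one_smul], by rw [h.idem, one_smul]⟩

theorem one_sub_idem (h : FaithfulIdem e) : IsPeirce e 0 0 (1 - e) :=
  ⟨by simp [mul_sub, h.idem], by simp [sub_mul, h.idem]⟩

variable [IsAddTorsionFree A]

theorem eq_zero_of_left (h : FaithfulIdem e) (hx : e * x = i • x) (h0 : i ≠ 0) (h1 : i ≠ 1) :
    x = 0 := by
  have h2 := h.mul_mul_left x
  rw [hx, mul_smul_comm, hx] at h2
  have h3 : (i * (i - 1)) • x = 0 := by linear_combination (norm := module) h2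
  exact (smul_eq_zero.mp h3).resolve_left (mul_ne_zero h0 (sub_ne_zero.mpr h1))

theorem eq_zero_of_right (h : FaithfulIdem e) (hx : x * e = j • x) (h0 : j ≠ 0) (h1 : j ≠ 1) :
    x = 0 := by
  have h2 := h.mul_mul_right x
  rw [hx, smul_mul_assoc, hx] at h2
  have h3 : (j * (j - 1)) • x = 0 := by linear_combination (norm := module) h2
  exact (smul_eq_zero.mp h3).resolve_left (mul_ne_zero h0 (sub_ne_zero.mpr h1))

theorem eq_zero_of_mul_offDiag (h : FaithfulIdem e) (hx : IsPeirce e 1 1 x)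
    (hz : ∀ c, IsPeirce e 1 0 c → x * c = 0) : x = 0 := by
  refine h.faithful_compl x fun r => ?_
  obtain ⟨a, b, c, d, ha, hb, hc, hd, rfl⟩ := h.exists_decomp r
  have hc' : x * c = 0 := eq_zero_of_left h (hx.mul h hc).left (by norm_num) (by norm_num)
  have hd' : x * d = 0 := eq_zero_of_left h (hx.mul h hd).left (by norm_num) (by norm_num)
  have ha' := (hx.mul h ha).right
  norm_num at ha'
  simp [mul_add, hz b hb, hc', hd', mul_sub, ha']

end IsPeirce


theorem right_idem {e : A} (h : FaithfulIdem e) (t : A) : starJordan e t = e * t + t * e := by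
  rw [starJordan, h.star_eq]

theorem right_eq_zero_of_isPeirce {e x : A} (h : FaithfulIdem e) (hx : IsPeirce e 0 0 x) :
    starJordan e x = 0 := by
  rw [right_idem h, hx.left, hx.right]; simp

theorem right_eq_of_isPeirce₁₀ {e x : A} (h : FaithfulIdem e) (hx : IsPeirce e 1 0 x) :
    starJordan e x = x := by
  rw [right_idem h, hx.left, hx.right]; simp

theorem right_eq_of_isPeirce₀₁ {e x : A} (h : FaithfulIdem e) (hx : IsPeirce e 0 1 x) :
    starJordan e x = x := by
  rw [right_idem h, hx.left, hx.right]; simp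

theorem right_reflection_eq_zero₁₀ {e x : A} (h : FaithfulIdem e) (hx : IsPeirce e 1 0 x) :
    starJordan (e - (1 - e)) x = 0 := by
  rw [sub_left, right_idem h, right_idem h.compl, hx.compl.left, hx.compl.right, hx.left, hx.right]
  simp

theorem right_reflection_eq_zero₀₁ {e x : A} (h : FaithfulIdem e) (hx : IsPeirce e 0 1 x) :
    starJordan (e - (1 - e)) x = 0 := by
  rw [sub_left, right_idem h, right_idem h.compl, hx.compl.left, hx.compl.right, hx.left, hx.right]
  simp

theorem left_idem_eq_zero {e x : A} (h : FaithfulIdem e) (hx : IsPeirce e 1 0 x) :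
    starJordan x e = 0 := by
  rw [starJordan, hx.right, (hx.star h).left]; simp

/-- A map satisfying the `•`-derivation rule up to a scalar `N` and an additive correction `S`. -/
structure ScaledDerivation (N : ℤ) (S : A →+ A) (Φ : A → A) : Prop where
  ne_zero : N ≠ 0
  map_smul : ∀ x y, Φ (N • starJordan x y) =
    starJordan (N • Φ x + S x) y + N • starJordan x (Φ y)

namespace ScaledDerivation

variable {N : ℤ} {S : A →+ A} {Φ : A → A} {e : A}

theorem map_zero (hΦ : ScaledDerivation N S Φ) : Φ 0 = 0 := by
  have := hΦ.map_smul 0 0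
  simpa [starJordan] using this

variable [IsAddTorsionFree A]

theorem right_defect (hΦ : ScaledDerivation N S Φ) {x a b : A}
    (hab : Φ (N • starJordan x a + N • starJordan x b) =
      Φ (N • starJordan x a) + Φ (N • starJordan x b)) :
    starJordan x (Φ (a + b) - Φ a - Φ b) = 0 := by
  rw [← smul_add, ← add_right, hΦ.map_smul, hΦ.map_smul, hΦ.map_smul, add_right] at hab
  refine zsmul_right_injective hΦ.ne_zero ?_
  simp only [sub_right]
  linear_combination (norm := module) hab

theorem left_defect (hΦ : ScaledDerivation N S Φ) {y a b : A}
    (hab : Φ (N • starJordan a y + N • starJordan b y) =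
      Φ (N • starJordan a y) + Φ (N • starJordan b y)) :
    starJordan (Φ (a + b) - Φ a - Φ b) y = 0 := by
  rw [← smul_add, ← add_left, hΦ.map_smul, hΦ.map_smul, hΦ.map_smul] at hab
  simp only [add_left, zsmul_left, _root_.map_add] at hab
  refine zsmul_right_injective hΦ.ne_zero ?_
  simp only [sub_left]
  linear_combination (norm := module) hab

theorem right_defect_of_left (hΦ : ScaledDerivation N S Φ) {x a b : A}
    (ha : starJordan x a = 0) : starJordan x (Φ (a + b) - Φ a - Φ b) = 0 :=
  hΦ.right_defect (by simp [ha, hΦ.map_zero])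

theorem right_defect_of_right (hΦ : ScaledDerivation N S Φ) {x a b : A}
    (hb : starJordan x b = 0) : starJordan x (Φ (a + b) - Φ a - Φ b) = 0 :=
  hΦ.right_defect (by simp [hb, hΦ.map_zero])

theorem left_defect_of_left (hΦ : ScaledDerivation N S Φ) {y a b : A}
    (ha : starJordan a y = 0) : starJordan (Φ (a + b) - Φ a - Φ b) y = 0 :=
  hΦ.left_defect (by simp [ha, hΦ.map_zero])

theorem left_defect_of_right (hΦ : ScaledDerivation N S Φ) {y a b : A}
    (hb : starJordan b y = 0) : starJordan (Φ (a + b) - Φ a - Φ b) y = 0 :=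
  hΦ.left_defect (by simp [hb, hΦ.map_zero])

theorem isPeirce₁₀_of_tests (h : FaithfulIdem e) {t : A} (h1 : starJordan t e = 0)
    (h2 : starJordan (e - (1 - e)) t = 0) : IsPeirce e 1 0 t := by
  rw [starJordan] at h1
  rw [sub_left, right_idem h, right_idem h.compl] at h2
  simp only [sub_mul, mul_sub, one_mul, mul_one] at h2
  have h3 : e * t + t * e = t := by
    refine zsmul_right_injective (two_ne_zero : (2 : ℤ) ≠ 0) ?_
    linear_combination (norm := module) h2
  have h4 : e * (t * e) = 0 := by
    have := congrArg (e * ·) h3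
    simp only [mul_add, h.mul_mul_left] at this
    linear_combination (norm := module) this
  have h5 : e * (e * star t) = 0 := by
    have := congrArg (e * ·) h1
    simpa [mul_add, h.mul_mul_left, h4] using this
  rw [h.mul_mul_left] at h5
  have h6 : t * e = 0 := by simpa [h5] using h1
  exact ⟨by simpa [h6] using h3, by simpa using h6⟩

theorem add_offDiag (hΦ : ScaledDerivation N S Φ) (h : FaithfulIdem e) {a b : A}
    (ha : IsPeirce e 1 0 a) (hb : IsPeirce e 0 1 b) : Φ (a + b) = Φ a + Φ b := by
  set t := Φ (a + b) - Φ a - Φ b with ht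
  have h1 : starJordan t e = 0 := hΦ.left_defect_of_left (left_idem_eq_zero h ha)
  have h2 : starJordan t (1 - e) = 0 :=
    hΦ.left_defect_of_right (left_idem_eq_zero h.compl (by simpa using hb.compl))
  have h3 : starJordan (e - (1 - e)) t = 0 :=
    hΦ.right_defect_of_left (right_reflection_eq_zero₁₀ h ha)
  have h4 := isPeirce₁₀_of_tests h h1 h3
  have h5 := isPeirce₁₀_of_tests h.compl h2 (t := t) (by
    rw [sub_left] at h3 ⊢
    rw [sub_sub_cancel, ← neg_sub, h3, neg_zero])
  have h6 : t = 0 := by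
    have := h5.left
    rw [sub_mul, h4.left] at this
    simpa using this.symm
  linear_combination (norm := module) ht.symm.trans h6

theorem eq_zero_of_right (h : FaithfulIdem e) {t : A} (h1 : starJordan e t = 0)
    (h2 : starJordan (1 - e) t = 0) : t = 0 := by
  rw [right_idem h] at h1
  rw [right_idem h.compl] at h2
  simp only [sub_mul, mul_sub, one_mul, mul_one] at h2
  refine zsmul_right_injective (two_ne_zero : (2 : ℤ) ≠ 0) ?_
  linear_combination (norm := module) h1 + h2

theorem add_diag_offDiag (hΦ : ScaledDerivation N S Φ) (h : FaithfulIdem e) {a b c : A}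
    (ha : IsPeirce e 1 1 a) (hb : IsPeirce e 1 0 b) (hc : IsPeirce e 0 1 c) :
    Φ (a + (b + c)) = Φ a + Φ (b + c) := by
  set t := Φ (a + (b + c)) - Φ a - Φ (b + c) with ht
  have h1 : starJordan (1 - e) t = 0 :=
    hΦ.right_defect_of_left (right_eq_zero_of_isPeirce h.compl (by simpa using ha.compl))
  have h2 : starJordan (e - (1 - e)) t = 0 :=
    hΦ.right_defect_of_right (by
      rw [add_right, right_reflection_eq_zero₁₀ h hb, right_reflection_eq_zero₀₁ h hc, add_zero])
  have h3 : t = 0 := eq_zero_of_right h (by simpa [sub_left, h1] using h2) h1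
  linear_combination (norm := module) ht.symm.trans h3

theorem add_diag (hΦ : ScaledDerivation N S Φ) (h : FaithfulIdem e) {a b c d : A}
    (ha : IsPeirce e 1 1 a) (hb : IsPeirce e 1 0 b) (hc : IsPeirce e 0 1 c)
    (hd : IsPeirce e 0 0 d) :
    Φ (a + (b + c) + d) = Φ a + (Φ b + Φ c) + Φ d := by
  set t := Φ (a + (b + c) + d) - Φ (a + (b + c)) - Φ d with ht
  have h1 : starJordan e t = 0 :=
    hΦ.right_defect_of_right (right_eq_zero_of_isPeirce h hd)
  have h2 : starJordan (1 - e) t = 0 := by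
    have hb' : IsPeirce (1 - e) 0 1 b := by simpa using hb.compl
    have hc' : IsPeirce (1 - e) 1 0 c := by simpa using hc.compl
    have hd' : IsPeirce (1 - e) 1 1 d := by simpa using hd.compl
    have ha' : IsPeirce (1 - e) 0 0 a := by simpa using ha.compl
    refine hΦ.right_defect ?_
    have e1 : starJordan (1 - e) (a + (b + c)) = c + b := by
      rw [add_right, add_right, right_eq_zero_of_isPeirce h.compl ha',
        right_eq_of_isPeirce₀₁ h.compl hb', right_eq_of_isPeirce₁₀ h.compl hc']
      abel
    have e2 : starJordan (1 - e) d = (2 : ℤ) • d := by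
      rw [right_idem h.compl, hd'.left, hd'.right]; module
    rw [e1, e2, smul_add, add_comm, add_comm (Φ _)]
    exact hΦ.add_diag_offDiag h.compl ((hd'.zsmul 2).zsmul N) (hc'.zsmul N) (hb'.zsmul N)
  have h3 := eq_zero_of_right h h1 h2
  rw [← hΦ.add_offDiag h hb hc, ← hΦ.add_diag_offDiag h ha hb hc]
  linear_combination (norm := module) ht.symm.trans h3

theorem add_peirce₁₀ (hΦ : ScaledDerivation N S Φ) (h : FaithfulIdem e)
    (hN : ∀ x : A, ∃ y, x = N • y) {a b : A}
    (ha : IsPeirce e 1 0 a) (hb : IsPeirce e 1 0 b) : Φ (a + b) = Φ a + Φ b := by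
  have defect_mem : ∀ {f u v : A}, FaithfulIdem f → IsPeirce f 1 0 u → IsPeirce f 1 0 v →
      IsPeirce f 1 0 (Φ (u + v) - Φ u - Φ v) := fun hf hu hv =>
    isPeirce₁₀_of_tests hf (hΦ.left_defect_of_left (left_idem_eq_zero hf hu))
      (hΦ.right_defect_of_left (right_reflection_eq_zero₁₀ hf hu))
  have ht := defect_mem h ha hb
  obtain ⟨a, rfl⟩ := hN a
  obtain ⟨b, rfl⟩ := hN b
  replace ha := ha.of_zsmul hΦ.ne_zero
  replace hb := hb.of_zsmul hΦ.ne_zero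
  have hs := ha.star h
  have hab : IsPeirce e 0 1 (a * b) := by simpa using ha.mul h hb
  have hba : IsPeirce e 1 1 (b * star a) := by simpa using hb.mul h hs
  have he := IsPeirce.idem h
  have hf := IsPeirce.one_sub_idem h
  have h0 : IsPeirce e 0 0 (0 : A) := ⟨by simp, by simp⟩
  have h01 : IsPeirce e 0 1 (0 : A) := ⟨by simp, by simp⟩
  have h10 : IsPeirce e 1 0 (0 : A) := ⟨by simp, by simp⟩
  have h11 : IsPeirce e 1 1 (0 : A) := ⟨by simp, by simp⟩
  have hs' : IsPeirce (1 - e) 1 0 (star a) := by simpa using hs.compl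
  have hab' : IsPeirce (1 - e) 1 0 (a * b) := by simpa using hab.compl
  have hu := defect_mem h.compl (hab'.zsmul N) (hs'.zsmul N)
  have p1 : starJordan e (1 - e) = 0 := right_eq_zero_of_isPeirce h hf
  have p2 : starJordan e b = b := right_eq_of_isPeirce₁₀ h hb
  have p3 : starJordan a (1 - e) = a + star a := by
    rw [starJordan, hs'.left, mul_sub, ha.right]; simp
  have p4 : starJordan a b = a * b + b * star a := rfl
  have key := hΦ.map_smul (e + a) ((1 - e) + b)
  have q1 : Φ (e + a) = Φ e + Φ a := by
    simpa [hΦ.map_zero] using hΦ.add_diag h he ha h01 h0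
  have q2 : Φ ((1 - e) + b) = Φ (1 - e) + Φ b := by
    simpa [hΦ.map_zero, add_comm] using hΦ.add_diag h h11 hb h01 hf
  have r1 : Φ (N • starJordan (e + a) ((1 - e) + b)) =
      Φ (N • (b * star a)) + (Φ (N • a + N • b) + Φ (N • (a * b) + N • star a)) := by
    have := hΦ.add_diag h (hba.zsmul N) ((ha.zsmul N).add (hb.zsmul N))
      ((hab.zsmul N).add (hs.zsmul N)) h0
    simp only [hΦ.map_zero, add_zero] at this
    rw [← this]
    congr 1
    simp only [add_left, add_right, p1, p2, p3, p4]
    module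
  have m1 := hΦ.map_smul e (1 - e)
  have m2 := hΦ.map_smul e b
  have m3 := hΦ.map_smul a (1 - e)
  have m4 := hΦ.map_smul a b
  have s3 : Φ (N • starJordan a (1 - e)) = Φ (N • a) + Φ (N • star a) := by
    rw [p3, smul_add]; exact hΦ.add_offDiag h (ha.zsmul N) (hs.zsmul N)
  have s4 : Φ (N • starJordan a b) = Φ (N • (a * b)) + Φ (N • (b * star a)) := by
    have := hΦ.add_diag h (hba.zsmul N) h10 (hab.zsmul N) h0
    simp only [hΦ.map_zero, add_zero, zero_add] at this
    rw [p4, smul_add, add_comm, this, add_comm]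
  rw [r1, q1, q2] at key
  rw [p1, smul_zero, hΦ.map_zero] at m1
  rw [p2] at m2
  rw [s3] at m3
  rw [s4] at m4
  simp only [add_left, add_right, smul_add, _root_.map_add, zsmul_left] at key m1 m2 m3 m4
  have sum : (Φ (N • a + N • b) - Φ (N • a) - Φ (N • b)) +
      (Φ (N • (a * b) + N • star a) - Φ (N • (a * b)) - Φ (N • star a)) = 0 := by
    linear_combination (norm := module) key - m1 - m2 - m3 - m4
  have l1 := ht.left
  have l2 := hu.compl.left
  simp only [sub_sub_cancel, sub_self, zero_smul, one_smul] at l1 l2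
  have l3 := congrArg (e * ·) sum
  simp only [mul_add, mul_zero] at l3
  rw [l1, l2, add_zero] at l3
  linear_combination (norm := module) l3

theorem add_peirce₁₁ (hΦ : ScaledDerivation N S Φ) (h : FaithfulIdem e)
    (hN : ∀ x : A, ∃ y, x = N • y) {a b : A}
    (ha : IsPeirce e 1 1 a) (hb : IsPeirce e 1 1 b) : Φ (a + b) = Φ a + Φ b := by
  set t := Φ (a + b) - Φ a - Φ b with ht
  have h1 : starJordan (1 - e) t = 0 :=
    hΦ.right_defect_of_left (right_eq_zero_of_isPeirce h.compl (by simpa using ha.compl))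
  rw [right_idem h.compl] at h1
  simp only [sub_mul, mul_sub, one_mul, mul_one] at h1
  have h2 : e * t = e * (t * e) := by
    have := congrArg (e * ·) h1
    simp only [mul_sub, mul_add, h.mul_mul_left, mul_zero] at this
    linear_combination (norm := module) this
  have h3 : t * e = e * (t * e) := by
    have := congrArg (· * e) h1
    simp only [sub_mul, add_mul, h.mul_mul_right, zero_mul, h.flexible] at this
    linear_combination (norm := module) this
  have h4 : e * t = t := by
    refine zsmul_right_injective (two_ne_zero : (2 : ℤ) ≠ 0) ?_
    linear_combination (norm := module) h2 - h3 - h1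
  have h5 : IsPeirce e 1 1 t := ⟨by rw [h4, one_smul], by rw [h3, ← h2, h4, one_smul]⟩
  have left_kill : ∀ {u c : A}, IsPeirce e 1 1 u → IsPeirce e 1 0 c → starJordan u c = u * c :=
    fun hu hc => by
      have := IsPeirce.eq_zero_of_right h (hc.mul h (hu.star h)).right (by norm_num) (by norm_num)
      rw [starJordan, this, add_zero]
  have h6 : t = 0 := by
    refine IsPeirce.eq_zero_of_mul_offDiag h h5 fun c hc => ?_
    rw [← left_kill h5 hc]
    refine hΦ.left_defect ?_
    rw [left_kill ha hc, left_kill hb hc]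
    exact hΦ.add_peirce₁₀ h hN (by simpa using (ha.mul h hc).zsmul N)
      (by simpa using (hb.mul h hc).zsmul N)
  linear_combination (norm := module) ht.symm.trans h6

theorem map_add (hΦ : ScaledDerivation N S Φ) (h : FaithfulIdem e)
    (hN : ∀ x : A, ∃ y, x = N • y) (a b : A) : Φ (a + b) = Φ a + Φ b := by
  obtain ⟨a₁, a₂, a₃, a₄, ha₁, ha₂, ha₃, ha₄, rfl⟩ := h.exists_decomp a
  obtain ⟨b₁, b₂, b₃, b₄, hb₁, hb₂, hb₃, hb₄, rfl⟩ := h.exists_decomp b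
  have := hΦ.add_diag h (ha₁.add hb₁) (ha₂.add hb₂) (ha₃.add hb₃) (ha₄.add hb₄)
  rw [hΦ.add_peirce₁₁ h hN ha₁ hb₁, hΦ.add_peirce₁₀ h hN ha₂ hb₂,
    hΦ.add_peirce₁₀ (a := a₃) (b := b₃) h.compl hN (by simpa using ha₃.compl)
      (by simpa using hb₃.compl),
    hΦ.add_peirce₁₁ (a := a₄) (b := b₄) h.compl hN (by simpa using ha₄.compl)
      (by simpa using hb₄.compl)] at this
  rw [hΦ.add_diag h ha₁ ha₂ ha₃ ha₄, hΦ.add_diag h hb₁ hb₂ hb₃ hb₄]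
  have regroup : a₁ + (a₂ + a₃) + a₄ + (b₁ + (b₂ + b₃) + b₄) =
      a₁ + b₁ + (a₂ + b₂ + (a₃ + b₃)) + (a₄ + b₄) := by abel
  rw [regroup, this]
  abel

end ScaledDerivation

/-- An additive map satisfying the derivation rule for `•`, whose value at `1` is a left
annihilator for `•`. -/
structure AddDerivation (D : A →+ A) : Prop where
  map_starJordan : ∀ x y, D (starJordan x y) = starJordan (D x) y + starJordan x (D y)
  map_one_starJordan : ∀ y, starJordan (D 1) y = 0

theorem leibnizDefect_assoc_left {e : A} (h : FaithfulIdem e) (D : A →+ A) (a b c : A) :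
    leibnizDefect D (a * b) c + leibnizDefect D a b * c - leibnizDefect D a (b * c)
        - a * leibnizDefect D b c
      + (leibnizDefect D (b * a) c + leibnizDefect D b a * c - leibnizDefect D b (a * c)
        - b * leibnizDefect D a c) = 0 := by
  have h0 := congrArg D (h.assoc_left a b c)
  have h1 := h.assoc_left (D a) b c
  have h2 := h.assoc_left a (D b) c
  have h3 := h.assoc_left a b (D c)
  simp only [map_add, map_sub, map_zero] at h0
  simp only [leibnizDefect, mul_sub, sub_mul]
  linear_combination (norm := module) h0 - h1 - h2 - h3

theorem leibnizDefect_assoc_right {e : A} (h : FaithfulIdem e) (D : A →+ A) (a b c : A) :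
    leibnizDefect D (a * b) c + leibnizDefect D a b * c - leibnizDefect D a (b * c)
        - a * leibnizDefect D b c
      + (leibnizDefect D (a * c) b + leibnizDefect D a c * b - leibnizDefect D a (c * b)
        - a * leibnizDefect D c b) = 0 := by
  have h0 := congrArg D (h.assoc_right a b c)
  have h1 := h.assoc_right (D a) b c
  have h2 := h.assoc_right a (D b) c
  have h3 := h.assoc_right a b (D c)
  simp only [map_add, map_sub, map_zero] at h0
  simp only [leibnizDefect, mul_sub, sub_mul]
  linear_combination (norm := module) h0 - h1 - h2 - h3

namespace AddDerivation

variable {D : A →+ A} {e : A}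

theorem star_map_one (hD : AddDerivation D) : star (D 1) = -D 1 := by
  have := hD.map_one_starJordan 1
  rw [starJordan, mul_one, one_mul] at this
  exact eq_neg_of_add_eq_zero_right this

theorem map_one_comm (hD : AddDerivation D) (y : A) : D 1 * y = y * D 1 := by
  have := hD.map_one_starJordan y
  rw [starJordan, hD.star_map_one, mul_neg] at this
  linear_combination (norm := module) this

theorem map_add_star (hD : AddDerivation D) (x : A) :
    D x + D (star x) = D x + star (D x) + D 1 * (x + star x) := by
  have := hD.map_starJordan x 1
  simp only [starJordan, mul_one, one_mul, map_add] at this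
  rw [this, mul_add, hD.map_one_comm x]

variable [IsAddTorsionFree A]

theorem mul_map_one_swap (hD : AddDerivation D) {g h : A} (hg : star g = g) (hh : star h = h) :
    g * (D 1 * h) = h * (D 1 * g) := by
  have h1 := hD.map_starJordan g h
  have h2 := hD.map_starJordan h g
  have h3 := hD.map_add_star g
  have h4 := hD.map_add_star h
  simp only [starJordan, hg, hh, map_add] at h1 h2 h3 h4
  have h5 := congrArg (h * ·) h3
  have h6 := congrArg (g * ·) h4
  simp only [mul_add] at h5 h6
  refine zsmul_right_injective (two_ne_zero : (2 : ℤ) ≠ 0) ?_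
  linear_combination (norm := module) h2 - h1 + h5 - h6

theorem map_one_mul_idem (hD : AddDerivation D) (h : FaithfulIdem e) : D 1 * e = 0 := by
  set T := D 1 with hT
  have hp : IsPeirce e 1 1 (T * e) := by
    refine ⟨?_, by rw [h.mul_mul_right, one_smul]⟩
    rw [hD.map_one_comm e, h.mul_mul_left, one_smul]
  have hq : IsPeirce e 0 0 (T * (1 - e)) := by
    refine ⟨?_, by rw [mul_sub, sub_mul, h.mul_mul_right]; simp⟩
    rw [mul_sub, mul_sub, hD.map_one_comm e, h.mul_mul_left, mul_one, zero_smul, sub_self]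
  set p := T * e with hpT
  set q := T * (1 - e) with hqT
  have hpq : T = p + q := by rw [hpT, hqT, ← mul_add]; simp
  refine IsPeirce.eq_zero_of_mul_offDiag h hp fun c hc => ?_
  have hc' := hc.star h
  have key := hD.mul_map_one_swap (g := c + star c) (h := e)
    (by rw [star_add, star_star, add_comm]) h.star_eq
  rw [← hT, ← hpT, hpq] at key
  have k1 : c * p = 0 :=
    IsPeirce.eq_zero_of_right h (hc.mul h hp).right (by norm_num) (by norm_num)
  have k2 : p * star c = 0 :=
    IsPeirce.eq_zero_of_left h (hp.mul h hc').left (by norm_num) (by norm_num)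
  have k3 : q * c = 0 :=
    IsPeirce.eq_zero_of_left h (hq.mul h hc).left (by norm_num) (by norm_num)
  have k4 := (hq.mul h hc').left
  have k5 := (hp.mul h hc).left
  have k6 := (hc'.mul h hp).left
  norm_num at k4 k5 k6
  simp only [add_mul, mul_add, k1, k2, k3, k4, k5, add_zero, zero_add] at key
  rw [← key, k6] at k5
  rw [← key, ← k5]

theorem map_one (hD : AddDerivation D) (h : FaithfulIdem e) : D 1 = 0 := by
  simpa [mul_sub, hD.map_one_mul_idem h] using hD.map_one_mul_idem h.compl

theorem map_star (hD : AddDerivation D) (h : FaithfulIdem e) (x : A) :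
    D (star x) = star (D x) := by
  simpa [hD.map_one h] using hD.map_add_star x

theorem leibnizDefect_swap (hD : AddDerivation D) (h : FaithfulIdem e) (x y : A) :
    leibnizDefect D x y = -leibnizDefect D y (star x) := by
  have := hD.map_starJordan x y
  simp only [starJordan, map_add] at this
  rw [leibnizDefect, leibnizDefect, hD.map_star h]
  linear_combination (norm := module) this

theorem leibnizDefect_one (hD : AddDerivation D) (h : FaithfulIdem e) (x : A) :
    leibnizDefect D 1 x = 0 := by
  simp [leibnizDefect, hD.map_one h]

theorem leibnizDefect_compl (hD : AddDerivation D) (h : FaithfulIdem e) (x : A) :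
    leibnizDefect D (1 - e) x = -leibnizDefect D e x := by
  have := leibnizDefect_add_left D (1 - e) e x
  rw [sub_add_cancel, hD.leibnizDefect_one h] at this
  exact eq_neg_of_add_eq_zero_left this.symm

theorem exists_map_idem (hD : AddDerivation D) (h : FaithfulIdem e) :
    ∃ p q, IsPeirce e 1 0 p ∧ IsPeirce e 0 1 q ∧ D e = p + q := by
  have h1 : D e = D e * e + e * D e := by
    have := hD.leibnizDefect_swap h e e
    rw [h.star_eq, self_eq_neg, leibnizDefect, h.idem] at this
    linear_combination (norm := module) this
  obtain ⟨a, b, c, d, ha, hb, hc, hd, hf⟩ := h.exists_decomp (D e)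
  refine ⟨b, c, hb, hc, ?_⟩
  rw [hf] at h1
  simp only [add_mul, mul_add, ha.left, ha.right, hb.left, hb.right, hc.left, hc.right, hd.left,
    hd.right] at h1
  have h2 : a = d := by linear_combination (norm := module) -h1
  have h3 := ha.left
  rw [h2, hd.left] at h3
  have h4 : d = 0 := by linear_combination (norm := module) -h3
  rw [hf, h2, h4]; abel

theorem leibnizDefect_idem_mem (hD : AddDerivation D) (h : FaithfulIdem e) {x : A}
    (hx : IsPeirce e 1 0 x) : IsPeirce e 0 1 (leibnizDefect D e x) := by
  obtain ⟨p, q, hp, hq, hf⟩ := hD.exists_map_idem h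
  constructor
  · rw [leibnizDefect, hx.left, hf, add_mul]
    have h1 := (hp.mul h hx).left
    have h2 := (hq.mul h hx).left
    norm_num at h1 h2
    simp [mul_sub, mul_add, h1, h2, h.mul_mul_left]
  · rw [hD.leibnizDefect_swap h, h.star_eq, leibnizDefect, hx.right, hf, mul_add]
    have h1 := (hx.mul h hp).right
    have h2 := (hx.mul h hq).right
    norm_num at h1 h2
    simp [add_mul, h1, h2, h.mul_mul_right]

theorem leibnizDefect_idem_offDiag (hD : AddDerivation D) (h : FaithfulIdem e) {x : A}
    (hx : IsPeirce e 1 0 x) : leibnizDefect D e x = 0 := by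
  have h1 := (hD.leibnizDefect_idem_mem h hx).left
  have hs : IsPeirce (1 - e) 1 0 (star x) := by simpa using (hx.star h).compl
  have h2 := (hD.leibnizDefect_idem_mem h.compl hs).left
  have h3 : leibnizDefect D e x = leibnizDefect D e (star x) := by
    rw [hD.leibnizDefect_swap h, h.star_eq, hD.leibnizDefect_swap h, neg_neg]
  rw [hD.leibnizDefect_compl h, ← h3, sub_mul] at h2
  simpa [h1] using h2

theorem leibnizDefect_idem_diag (hD : AddDerivation D) (h : FaithfulIdem e) {x : A}
    (hx : IsPeirce e 1 1 x) : leibnizDefect D e x = 0 := by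
  obtain ⟨p, q, hp, hq, hf⟩ := hD.exists_map_idem h
  have z1 : leibnizDefect D e x = D x - D e * x - e * D x := by
    rw [leibnizDefect, hx.left, one_smul]
  have z2 : leibnizDefect D e x = -(D x - D x * e - x * D e) := by
    rw [hD.leibnizDefect_swap h, h.star_eq, leibnizDefect, hx.right, one_smul]
  have px : p * x = 0 :=
    IsPeirce.eq_zero_of_right h (hp.mul h hx).right (by norm_num) (by norm_num)
  have xq : x * q = 0 :=
    IsPeirce.eq_zero_of_left h (hx.mul h hq).left (by norm_num) (by norm_num)
  have l1 := hq.mul h hx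
  have l2 := hx.mul h hp
  rw [hf, add_mul, px, zero_add] at z1
  rw [hf, mul_add, xq, add_zero] at z2
  have w1 := congrArg (e * ·) z1
  have w2 := congrArg (· * e) z2
  have w3 := congrArg (· * e) z1
  have w4 := congrArg (e * ·) z2
  simp only [mul_sub, sub_mul, neg_mul, mul_neg, h.mul_mul_left, h.mul_mul_right, h.flexible,
    l1.left, l1.right, l2.left, l2.right] at w1 w2 w3 w4
  refine zsmul_right_injective (two_ne_zero : (2 : ℤ) ≠ 0) ?_
  linear_combination (norm := module) z1 + z2 + w1 + w2 - w3 - w4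

theorem leibnizDefect_idem (hD : AddDerivation D) (h : FaithfulIdem e) (x : A) :
    leibnizDefect D e x = 0 := by
  obtain ⟨a, b, c, d, ha, hb, hc, hd, rfl⟩ := h.exists_decomp x
  have h3 := hD.leibnizDefect_idem_offDiag h.compl (x := c) (by simpa using hc.compl)
  have h4 := hD.leibnizDefect_idem_diag h.compl (x := d) (by simpa using hd.compl)
  rw [hD.leibnizDefect_compl h, neg_eq_zero] at h3 h4
  simp only [leibnizDefect_add_right, hD.leibnizDefect_idem_diag h ha,
    hD.leibnizDefect_idem_offDiag h hb, h3, h4, add_zero]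

theorem leibnizDefect_idem_right (hD : AddDerivation D) (h : FaithfulIdem e) (x : A) :
    leibnizDefect D x e = 0 := by
  have := hD.leibnizDefect_swap h e x
  rw [h.star_eq, hD.leibnizDefect_idem h] at this
  exact neg_eq_zero.mp this.symm

variable {i j k l : ℤ} {x y : A}

theorem isPeirce_leibnizDefect (hD : AddDerivation D) (h : FaithfulIdem e)
    (hx : IsPeirce e i j x) (hy : IsPeirce e k l y) :
    IsPeirce e (i + j - k) (k + l - j) (leibnizDefect D x y) where
  left := by
    have := leibnizDefect_assoc_left h D e x y
    simp only [hx.left, hx.right, hy.left, leibnizDefect_zsmul_left, leibnizDefect_zsmul_right,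
      hD.leibnizDefect_idem h, hD.leibnizDefect_idem_right h, zero_mul, mul_zero] at this
    linear_combination (norm := module) -this
  right := by
    have := leibnizDefect_assoc_right h D x e y
    simp only [hx.right, hy.left, hy.right, leibnizDefect_zsmul_left, leibnizDefect_zsmul_right,
      hD.leibnizDefect_idem h, hD.leibnizDefect_idem_right h, zero_mul, mul_zero] at this
    linear_combination (norm := module) this

theorem leibnizDefect_eq_zero_of_ne (hD : AddDerivation D) (h : FaithfulIdem e)
    (hx : IsPeirce e i j x) (hy : IsPeirce e k l y)
    (hne : i + 2 * j ≠ 2 * k + l ∨ i + 2 * j ≠ k + 2 * l) : leibnizDefect D x y = 0 := by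
  have h1 := hD.isPeirce_leibnizDefect h hx hy
  have h2 := (hD.isPeirce_leibnizDefect h hy (hx.star h)).zsmul (-1)
  rw [neg_one_zsmul, ← hD.leibnizDefect_swap h] at h2
  rcases hne with hne | hne
  · have h3 : (i + 2 * j - (2 * k + l)) • leibnizDefect D x y = 0 := by
      linear_combination (norm := module) h2.left - h1.left
    exact (smul_eq_zero.mp h3).resolve_left (sub_ne_zero.mpr hne)
  · have h3 : (i + 2 * j - (k + 2 * l)) • leibnizDefect D x y = 0 := by
      linear_combination (norm := module) h1.right - h2.right
    exact (smul_eq_zero.mp h3).resolve_left (sub_ne_zero.mpr hne)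

theorem leibnizDefect_diag (hD : AddDerivation D) (h : FaithfulIdem e)
    (hx : IsPeirce e 1 1 x) (hy : IsPeirce e 1 1 y) : leibnizDefect D x y = 0 := by
  refine IsPeirce.eq_zero_of_mul_offDiag h
    (by simpa using hD.isPeirce_leibnizDefect h hx hy) fun c hc => ?_
  have key := leibnizDefect_assoc_right h D x y c
  rw [hD.leibnizDefect_eq_zero_of_ne h (hx.mul h hy) hc (by norm_num),
    hD.leibnizDefect_eq_zero_of_ne h hx (hy.mul h hc) (by norm_num),
    hD.leibnizDefect_eq_zero_of_ne h hy hc (by norm_num),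
    hD.leibnizDefect_eq_zero_of_ne h (hx.mul h hc) hy (by norm_num),
    hD.leibnizDefect_eq_zero_of_ne h hx hc (by norm_num),
    hD.leibnizDefect_eq_zero_of_ne h hx (hc.mul h hy) (by norm_num),
    hD.leibnizDefect_eq_zero_of_ne h hc hy (by norm_num)] at key
  simpa using key

theorem leibnizDefect_eq_zero (hD : AddDerivation D) (h : FaithfulIdem e) (x y : A) :
    leibnizDefect D x y = 0 := by
  obtain ⟨a₁, a₂, a₃, a₄, ha₁, ha₂, ha₃, ha₄, rfl⟩ := h.exists_decomp x
  obtain ⟨b₁, b₂, b₃, b₄, hb₁, hb₂, hb₃, hb₄, rfl⟩ := h.exists_decomp y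
  have h₄₄ : leibnizDefect D a₄ b₄ = 0 :=
    hD.leibnizDefect_diag h.compl (by simpa using ha₄.compl) (by simpa using hb₄.compl)
  simp only [leibnizDefect_add_left, leibnizDefect_add_right, h₄₄, hD.leibnizDefect_diag h ha₁ hb₁]
  rw [hD.leibnizDefect_eq_zero_of_ne h ha₁ hb₂ (by norm_num),
    hD.leibnizDefect_eq_zero_of_ne h ha₁ hb₃ (by norm_num),
    hD.leibnizDefect_eq_zero_of_ne h ha₁ hb₄ (by norm_num),
    hD.leibnizDefect_eq_zero_of_ne h ha₂ hb₁ (by norm_num),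
    hD.leibnizDefect_eq_zero_of_ne h ha₂ hb₂ (by norm_num),
    hD.leibnizDefect_eq_zero_of_ne h ha₂ hb₃ (by norm_num),
    hD.leibnizDefect_eq_zero_of_ne h ha₂ hb₄ (by norm_num),
    hD.leibnizDefect_eq_zero_of_ne h ha₃ hb₁ (by norm_num),
    hD.leibnizDefect_eq_zero_of_ne h ha₃ hb₂ (by norm_num),
    hD.leibnizDefect_eq_zero_of_ne h ha₃ hb₃ (by norm_num),
    hD.leibnizDefect_eq_zero_of_ne h ha₃ hb₄ (by norm_num),
    hD.leibnizDefect_eq_zero_of_ne h ha₄ hb₁ (by norm_num),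
    hD.leibnizDefect_eq_zero_of_ne h ha₄ hb₂ (by norm_num),
    hD.leibnizDefect_eq_zero_of_ne h ha₄ hb₃ (by norm_num)]
  simp

theorem map_mul (hD : AddDerivation D) (h : FaithfulIdem e) (x y : A) :
    D (x * y) = D x * y + x * D y := by
  have := hD.leibnizDefect_eq_zero h x y
  rw [leibnizDefect] at this
  linear_combination (norm := module) this

end AddDerivation

theorem leftStarJordan_ofFn (m : ℕ) (f : Fin (m + 2) → A) :
    leftStarJordan (List.ofFn f) =
      starJordan (leftStarJordan (List.ofFn fun i : Fin (m + 1) => f i.castSucc))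
        (f (Fin.last _)) := by
  rw [List.ofFn_succ', List.ofFn_succ]
  simp [leftStarJordan]

theorem leftStarJordan_one (m : ℕ) :
    leftStarJordan (List.ofFn fun _ : Fin (m + 1) => (1 : A)) = (2 ^ m : ℤ) • (1 : A) := by
  induction m with
  | zero => simp [leftStarJordan]
  | succ m ih =>
    rw [leftStarJordan_ofFn, ih, zsmul_left, starJordan]
    simp only [mul_one, star_one, pow_succ]
    module

/-- The `•`-product of `m + 1` ones with the `k`-th one replaced by `t`. -/
def onesUpdate (m : ℕ) (k : Fin (m + 1)) (t : A) : A :=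
  leftStarJordan (List.ofFn (Function.update (fun _ => (1 : A)) k t))

theorem onesUpdate_zero (k : Fin 1) (t : A) : onesUpdate 0 k t = t := by
  rw [Subsingleton.elim k 0]
  simp [onesUpdate, leftStarJordan]

theorem onesUpdate_last (m : ℕ) (t : A) :
    onesUpdate (m + 1) (Fin.last _) t = (2 ^ m : ℤ) • (t + t) := by
  have : (fun i : Fin (m + 1) => Function.update (fun _ => (1 : A)) (Fin.last (m + 1)) t
      i.castSucc) = fun _ => 1 := by
    funext i; simp [Fin.castSucc_ne_last]
  rw [onesUpdate, leftStarJordan_ofFn, this, leftStarJordan_one, zsmul_left, starJordan]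
  simp

theorem onesUpdate_castSucc (m : ℕ) (k : Fin (m + 1)) (t : A) :
    onesUpdate (m + 1) k.castSucc t = onesUpdate m k t + star (onesUpdate m k t) := by
  have : (fun i : Fin (m + 1) => Function.update (fun _ => (1 : A)) k.castSucc t
      i.castSucc) = Function.update (fun _ => 1) k t := by
    funext i; simp [Function.update_apply]
  rw [onesUpdate, leftStarJordan_ofFn, this, ← onesUpdate, starJordan]
  simp [(Fin.castSucc_ne_last k).symm]

theorem onesUpdate_add_star (m : ℕ) (k : Fin (m + 1)) (t : A) :
    onesUpdate m k t + star (onesUpdate m k t) = (2 ^ m : ℤ) • (t + star t) := by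
  induction m with
  | zero => simp [onesUpdate_zero]
  | succ m ih =>
    induction k using Fin.lastCases with
    | last => rw [onesUpdate_last, star_zsmul, star_add, pow_succ]; module
    | cast k => rw [onesUpdate_castSucc, ih, star_zsmul, star_add, star_star, pow_succ]; module

theorem onesUpdate_skew (m : ℕ) (k : Fin (m + 1)) {t : A} (ht : t + star t = 0) :
    ∃ c : ℤ, onesUpdate m k t = c • t := by
  cases m with
  | zero => exact ⟨1, by simp [onesUpdate_zero]⟩
  | succ m =>
    induction k using Fin.lastCases with
    | last => exact ⟨2 ^ m * 2, by rw [onesUpdate_last]; module⟩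
    | cast k => exact ⟨0, by rw [onesUpdate_castSucc, onesUpdate_add_star, ht]; simp⟩

/-- The additive correction coming from the leading ones in the `n`-derivation identity. -/
def onesCorrection (m : ℕ) (t : A) : A →+ A where
  toFun x := ∑ k : Fin (m + 1), starJordan (onesUpdate m k t) x
  map_zero' := by simp [starJordan]
  map_add' x y := by simp [add_right, Finset.sum_add_distrib]

theorem onesCorrection_apply (m : ℕ) (t x : A) :
    onesCorrection m t x = ∑ k : Fin (m + 1), starJordan (onesUpdate m k t) x := rfl

theorem onesCorrection_one (m : ℕ) (t : A) :
    onesCorrection m t 1 = ((m + 1 : ℤ) * 2 ^ m) • (t + star t) := by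
  simp only [onesCorrection_apply, starJordan, mul_one, one_mul, onesUpdate_add_star]
  rw [Finset.sum_const, Finset.card_univ, Fintype.card_fin, mul_smul, ← natCast_zsmul]
  push_cast
  rfl

theorem onesCorrection_eq_zero (m : ℕ) {t : A} (ht : ∀ y, starJordan t y = 0) (x : A) :
    onesCorrection m t x = 0 := by
  rw [onesCorrection_apply]
  refine Finset.sum_eq_zero fun k _ => ?_
  obtain ⟨c, hc⟩ := onesUpdate_skew m k (t := t) (by simpa [starJordan] using ht 1)
  rw [hc, zsmul_left, ht, smul_zero]

theorem sum_left {ι : Type*} (s : Finset ι) (f : ι → A) (y : A) :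
    starJordan (∑ k ∈ s, f k) y = ∑ k ∈ s, starJordan (f k) y := by
  simp only [starJordan, Finset.sum_mul, Finset.mul_sum, star_sum, Finset.sum_add_distrib]

theorem leftStarJordan_ofFn_three (m : ℕ) (f : Fin (m + 3) → A) :
    leftStarJordan (List.ofFn f) =
      starJordan (starJordan
        (leftStarJordan (List.ofFn fun i : Fin (m + 1) => f i.castSucc.castSucc))
        (f (Fin.last _).castSucc)) (f (Fin.last _)) := by
  rw [leftStarJordan_ofFn, leftStarJordan_ofFn]

theorem scaledDerivation_of_three (m : ℕ) {Φ : A → A}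
    (hΦ : ∀ x y : A,
      Φ (leftStarJordan (List.ofFn (lastTwoFamily (m + 3) x y))) =
        ∑ k : Fin (m + 3), leftStarJordan (List.ofFn (Function.update (lastTwoFamily (m + 3) x y) k
          (Φ (lastTwoFamily (m + 3) x y k))))) :
    ScaledDerivation (2 ^ (m + 1)) (onesCorrection m (Φ 1)) Φ where
  ne_zero := by positivity
  map_smul x y := by
    have ones (z : A) : starJordan (leftStarJordan (List.ofFn fun _ : Fin (m + 1) => (1 : A))) z =
        (2 ^ (m + 1) : ℤ) • z := by
      rw [leftStarJordan_one, zsmul_left, starJordan, star_one, one_mul, mul_one, pow_succ]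
      module
    have key := hΦ x y
    rw [Fin.sum_univ_castSucc, Fin.sum_univ_castSucc] at key
    have upd (k : Fin (m + 1)) (t : A) :
        (fun i : Fin (m + 1) => Function.update (lastTwoFamily (m + 3) x y) k.castSucc.castSucc t
          i.castSucc.castSucc) = Function.update (fun _ => 1) k t := by
      funext i
      simp [Function.update_apply, lastTwoFamily_castSucc_castSucc]
    have upd₁ (t : A) : (fun i : Fin (m + 1) => Function.update (lastTwoFamily (m + 3) x y)
        (Fin.last (m + 1)).castSucc t i.castSucc.castSucc) = fun _ => 1 := by
      funext i
      simp [lastTwoFamily_castSucc_castSucc, Fin.castSucc_ne_last]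
    have upd₂ (t : A) : (fun i : Fin (m + 1) => Function.update (lastTwoFamily (m + 3) x y)
        (Fin.last (m + 2)) t i.castSucc.castSucc) = fun _ => 1 := by
      funext i
      simp [lastTwoFamily_castSucc_castSucc, Fin.castSucc_ne_last]
    have ne₁ (k : Fin (m + 1)) : Fin.last (m + 1) ≠ k.castSucc := (Fin.castSucc_ne_last k).symm
    have ne₂ (k : Fin (m + 2)) : Fin.last (m + 2) ≠ k.castSucc := (Fin.castSucc_ne_last k).symm
    simp only [leftStarJordan_ofFn_three, upd, upd₁, upd₂, lastTwoFamily_last,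
      lastTwoFamily_castSucc_last, lastTwoFamily_castSucc_castSucc, ones] at key
    simp only [Function.update_apply, ne₁, ne₂, Fin.castSucc_ne_last, if_false, if_true,
      lastTwoFamily_last, lastTwoFamily_castSucc_last, Fin.castSucc_inj] at key
    simp only [zsmul_left] at key
    rw [key, add_left, onesCorrection_apply, sum_left, zsmul_left]
    simp only [onesUpdate]
    abel

theorem scaledDerivation_of_two {Φ : A → A}
    (hΦ : ∀ x y : A,
      Φ (leftStarJordan (List.ofFn (lastTwoFamily 2 x y))) =
        ∑ k : Fin 2, leftStarJordan (List.ofFn (Function.update (lastTwoFamily 2 x y) k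
          (Φ (lastTwoFamily 2 x y k))))) :
    ScaledDerivation 1 (0 : A →+ A) Φ where
  ne_zero := one_ne_zero
  map_smul x y := by
    have := hΦ x y
    simpa [Fin.sum_univ_two, leftStarJordan, List.ofFn_succ, lastTwoFamily] using this

theorem ScaledDerivation.addDerivation [IsAddTorsionFree A] {N : ℤ} {S : A →+ A} {Φ : A → A} {e : A}
    (hΦ : ScaledDerivation N S Φ) (h : FaithfulIdem e) (hN : ∀ x : A, ∃ y, x = N • y)
    (hN_pos : 0 < N) {r : ℤ} (hr : 0 ≤ r) (hS_one : S 1 = r • (Φ 1 + star (Φ 1)))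
    (hS : (∀ y, starJordan (Φ 1) y = 0) → ∀ x, S x = 0) :
    AddDerivation (AddMonoidHom.mk' Φ (hΦ.map_add h hN)) := by
  set D := AddMonoidHom.mk' Φ (hΦ.map_add h hN) with hD
  have hDΦ (x : A) : Φ x = D x := rfl
  have h1 (y : A) : starJordan (N • D 1 + S 1) y = 0 := by
    have := hΦ.map_smul 1 y
    simp only [hDΦ, map_zsmul] at this
    have two (z : A) : starJordan 1 z = (2 : ℤ) • z := by
      rw [starJordan, star_one, one_mul, mul_one]; module
    rw [two, two, map_zsmul] at this
    simpa using this
  rw [hDΦ] at hS_one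
  have h2 : D 1 + star (D 1) = 0 := by
    have := h1 1
    rw [starJordan, mul_one, one_mul, hS_one] at this
    simp only [star_add, star_zsmul, star_star] at this
    have h3 : (N + 2 * r) • (D 1 + star (D 1)) = 0 := by linear_combination (norm := module) this
    exact (smul_eq_zero.mp h3).resolve_left (by omega)
  have h4 (y : A) : starJordan (D 1) y = 0 := by
    have := h1 y
    rw [hS_one, h2, smul_zero, add_zero, zsmul_left] at this
    exact (smul_eq_zero.mp this).resolve_left hΦ.ne_zero
  refine ⟨fun x y => ?_, h4⟩
  have := hΦ.map_smul x y
  rw [hS h4, add_zero, zsmul_left] at this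
  simp only [hDΦ, map_zsmul] at this
  refine zsmul_right_injective hΦ.ne_zero ?_
  simpa only [smul_add] using this

end StarJordan

theorem stmt_0 {A : Type*} [NonAssocRing A] [Module ℂ A]
    [SMulCommClass ℂ A A] [IsScalarTower ℂ A A] [StarRing A]
    (halt₁ : ∀ a b : A, a * a * b = a * (a * b))
    (halt₂ : ∀ a b : A, b * a * a = b * (a * a))
    (e : A) (heStar : star e = e) (heIdem : e * e = e) (he0 : e ≠ 0) (he1 : e ≠ 1)
    (hsp : ∀ x : A, (∀ r : A, x * r * e = 0) → x = 0)
    (hcl : ∀ x : A, (∀ r : A, x * r * (1 - e) = 0) → x = 0)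
    (n : ℕ) (hn : 2 ≤ n) (Φ : A → A)
    (hΦ : ∀ x y : A,
      Φ (leftStarJordan (List.ofFn (lastTwoFamily n x y))) =
        ∑ k : Fin n, leftStarJordan (List.ofFn
          (Function.update (lastTwoFamily n x y) k (Φ (lastTwoFamily n x y k))))) :
    (∀ a b : A, Φ (a + b) = Φ a + Φ b) ∧
      (∀ a b : A, Φ (a * b) = Φ a * b + a * Φ b) ∧
      (∀ a : A, Φ (star a) = star (Φ a)) := by
  have h : StarJordan.FaithfulIdem e := ⟨halt₁, halt₂, heStar, heIdem, hsp, hcl⟩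
  have : IsAddTorsionFree A := by
    have : IsAddTorsionFree ℂ := inferInstance
    refine ⟨fun m hm x y hxy => ?_⟩
    have hm' : (m : ℂ) ≠ 0 := by exact_mod_cast hm
    refine smul_right_injective A hm' ?_
    simpa only [Nat.cast_smul_eq_nsmul] using hxy
  have hdiv {N : ℤ} (hN : N ≠ 0) (x : A) : ∃ y, x = N • y := by
    refine ⟨(N : ℂ)⁻¹ • x, ?_⟩
    rw [← Int.cast_smul_eq_zsmul ℂ, smul_inv_smul₀ (by exact_mod_cast hN)]
  obtain ⟨D, hD, rfl⟩ : ∃ D : A →+ A, StarJordan.AddDerivation D ∧ ⇑D = Φ := by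
    obtain ⟨m, rfl⟩ := Nat.exists_eq_add_of_le' hn
    cases m with
    | zero =>
      have hS := StarJordan.scaledDerivation_of_two hΦ
      exact ⟨_, hS.addDerivation h (hdiv one_ne_zero) one_pos le_rfl (by simp) (by simp), rfl⟩
    | succ m =>
      have hS := StarJordan.scaledDerivation_of_three m hΦ
      exact ⟨_, hS.addDerivation h (hdiv hS.ne_zero) (by positivity) (by positivity)
        (StarJordan.onesCorrection_one m _) (StarJordan.onesCorrection_eq_zero m), rfl⟩
  exact ⟨map_add D, hD.map_mul h, hD.map_star h⟩
end

section
/- Let A be a unital alternative *-algebra over ℂ containing a nontrivial symmetric idempotent e satisfying conditions (♠) and (♣), and fix an integer n ≥ 2. A map Φ : A → A is a nonlinear *-Jordan n-derivation, i.e., Φ(a₁ • a₂ • ⋯ • a_n) = Σ_{k=1}^n a₁ • ⋯ • a_{k−1} • Φ(a_k) • a_{k+1} • ⋯ • a_n for all a₁, …, a_n ∈ A, if and only if Φ is an additive *-derivation, i.e., Φ(a + b) = Φ(a) + Φ(b), Φ(ab) = Φ(a)b + aΦ(b), and Φ(a*) = Φ(a)* for all a, b ∈ A. -/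
section Peirce

variable {A : Type*} [NonAssocRing A]

/-- `x` is a simultaneous eigenvector of left multiplication by `e` (eigenvalue `i`) and right
multiplication by `e` (eigenvalue `j`). -/
structure IsPeirce (e : A) (i j : ℤ) (x : A) : Prop where
  left : e * x = i • x
  right : x * e = j • x

variable {e : A}

namespace IsPeirce

variable {i j k l : ℤ} {x y : A}

theorem compl (hx : IsPeirce e i j x) : IsPeirce (1 - e) (1 - i) (1 - j) x where
  left := by rw [sub_mul, one_mul, hx.left]; module
  right := by rw [mul_sub, mul_one, hx.right]; module

theorem compl₁₁ (hx : IsPeirce e 1 1 x) : IsPeirce (1 - e) 0 0 x := by simpa using hx.compl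

theorem compl₁₂ (hx : IsPeirce e 1 0 x) : IsPeirce (1 - e) 0 1 x := by simpa using hx.compl

theorem compl₂₁ (hx : IsPeirce e 0 1 x) : IsPeirce (1 - e) 1 0 x := by simpa using hx.compl

theorem compl₂₂ (hx : IsPeirce e 0 0 x) : IsPeirce (1 - e) 1 1 x := by simpa using hx.compl

theorem zero (e : A) (i j : ℤ) : IsPeirce e i j 0 := ⟨by simp, by simp⟩

theorem add (hx : IsPeirce e i j x) (hy : IsPeirce e i j y) : IsPeirce e i j (x + y) where
  left := by rw [mul_add, hx.left, hy.left, smul_add]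
  right := by rw [add_mul, hx.right, hy.right, smul_add]

theorem zsmul (hx : IsPeirce e i j x) (n : ℤ) : IsPeirce e i j (n • x) where
  left := by rw [mul_smul_comm, hx.left, smul_comm]
  right := by rw [smul_mul_assoc, hx.right, smul_comm]

theorem eq_zero_of_ne [IsAddTorsionFree A] (hx : IsPeirce e i j x) (hy : IsPeirce e k l x)
    (hne : i ≠ k ∨ j ≠ l) : x = 0 := by
  rcases hne with hne | hne
  · have h₁ := hx.left.symm.trans hy.left
    rw [← sub_eq_zero, ← sub_smul, smul_eq_zero, sub_eq_zero] at h₁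
    exact h₁.resolve_left hne
  · have h₁ := hx.right.symm.trans hy.right
    rw [← sub_eq_zero, ← sub_smul, smul_eq_zero, sub_eq_zero] at h₁
    exact h₁.resolve_left hne

/-- The Peirce components of an element are unique. -/
theorem components_eq_zero {a b c d : A} (ha : IsPeirce e 1 1 a)
    (hb : IsPeirce e 1 0 b) (hc : IsPeirce e 0 1 c) (hd : IsPeirce e 0 0 d)
    (hs : a + b + c + d = 0) : a = 0 ∧ b = 0 ∧ c = 0 ∧ d = 0 := by
  have h₁ := congrArg (e * ·) hs
  have h₂ := congrArg (· * e) hs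
  have h₃ := congrArg (fun z => e * z * e) hs
  simp [mul_add, add_mul, ha.left, ha.right, hb.left, hb.right, hc.left, hc.right, hd.left,
    hd.right] at h₁ h₂ h₃
  subst h₃
  simp at h₁ h₂
  subst h₁ h₂
  simpa using hs

end IsPeirce

variable [StarRing A]

/-- A symmetric idempotent `e` of an alternative `*`-ring satisfying the two faithfulness conditions
`(♠)` and `(♣)`. -/
structure FaithfulSymmIdem (e : A) : Prop where
  left_alt : ∀ a b : A, a * a * b = a * (a * b)
  right_alt : ∀ a b : A, b * a * a = b * (a * a)
  star_eq : star e = e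
  idem : e * e = e
  faithful : ∀ x : A, (∀ r : A, x * r * e = 0) → x = 0
  faithful_compl : ∀ x : A, (∀ r : A, x * r * (1 - e) = 0) → x = 0

namespace FaithfulSymmIdem

theorem compl (h : FaithfulSymmIdem e) : FaithfulSymmIdem (1 - e) where
  left_alt := h.left_alt
  right_alt := h.right_alt
  star_eq := by rw [star_sub, star_one, h.star_eq]
  idem := by simp [mul_sub, sub_mul, h.idem]
  faithful := h.faithful_compl
  faithful_compl := by simpa using h.faithful

theorem associator_swap_left (h : FaithfulSymmIdem e) (a b c : A) :
    associator a b c = -associator b a c := by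
  have h₁ := h.left_alt (a + b) c
  simp only [add_mul, mul_add, h.left_alt a c, h.left_alt b c] at h₁
  simp only [associator]
  rw [← sub_eq_zero] at h₁ ⊢
  rw [← h₁]
  abel

theorem associator_swap_right (h : FaithfulSymmIdem e) (a b c : A) :
    associator a b c = -associator a c b := by
  have h₁ := h.right_alt (b + c) a
  simp only [add_mul, mul_add, h.right_alt b a, h.right_alt c a] at h₁
  simp only [associator]
  rw [← sub_eq_zero] at h₁ ⊢
  rw [← h₁]
  abel

theorem associator_self_left (h : FaithfulSymmIdem e) (a b : A) : associator a a b = 0 := by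
  simp [associator, h.left_alt]

theorem associator_self_outer (h : FaithfulSymmIdem e) (a b : A) : associator a b a = 0 := by
  rw [h.associator_swap_right, h.associator_self_left, neg_zero]

end FaithfulSymmIdem

namespace IsPeirce

variable {i j k l : ℤ} {x y : A}

protected theorem star (h : FaithfulSymmIdem e) (hx : IsPeirce e i j x) :
    IsPeirce e j i (star x) where
  left := by
    have := congrArg Star.star hx.right
    rwa [star_mul, h.star_eq, star_zsmul] at this
  right := by
    have := congrArg Star.star hx.left
    rwa [star_mul, h.star_eq, star_zsmul] at this

/-- The Peirce multiplication rules of an alternative ring, all sixteen at once. -/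
theorem mul (h : FaithfulSymmIdem e) (hx : IsPeirce e i j x) (hy : IsPeirce e k l y) :
    IsPeirce e (i + j - k) (k + l - j) (x * y) := by
  have h₁ := h.associator_swap_left e x y
  have h₂ := h.associator_swap_right x e y
  simp only [associator, hx.left, hx.right, hy.left, hy.right, smul_mul_assoc, mul_smul_comm]
    at h₁ h₂
  constructor
  · rw [← sub_eq_zero] at h₁ ⊢
    rw [← neg_eq_zero, ← h₁]
    module
  · rw [← sub_eq_zero] at h₂ ⊢
    rw [← neg_eq_zero, ← neg_eq_zero, ← h₂]
    module

variable [IsAddTorsionFree A]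

theorem eq_zero_of_left (h : FaithfulSymmIdem e) (hx : IsPeirce e i j x) (h0 : i ≠ 0)
    (h1 : i ≠ 1) : x = 0 := by
  have h₁ := h.left_alt e x
  rw [h.idem, hx.left, mul_smul_comm, hx.left, ← sub_eq_zero, smul_smul, ← sub_smul,
    smul_eq_zero] at h₁
  refine h₁.resolve_left fun h₂ => ?_
  have : i * (1 - i) = 0 := by linarith
  rcases mul_eq_zero.1 this with h₃ | h₃
  · exact h0 h₃
  · exact h1 (by linarith)

theorem eq_zero_of_right (h : FaithfulSymmIdem e) (hx : IsPeirce e i j x) (h0 : j ≠ 0)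
    (h1 : j ≠ 1) : x = 0 := by
  simpa using (hx.star h).eq_zero_of_left h h0 h1

end IsPeirce

namespace FaithfulSymmIdem

/-- Peirce decomposition. -/
theorem exists_decomp (h : FaithfulSymmIdem e) (x : A) :
    ∃ a b c d : A, IsPeirce e 1 1 a ∧ IsPeirce e 1 0 b ∧ IsPeirce e 0 1 c ∧ IsPeirce e 0 0 d ∧
      x = a + b + c + d := by
  have h₁ : ∀ y, e * (e * y) = e * y := fun y => by rw [← h.left_alt, h.idem]
  have h₂ : ∀ y, y * e * e = y * e := fun y => by rw [h.right_alt, h.idem]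
  have h₃ : ∀ y, e * y * e = e * (y * e) := fun y => by
    have := h.associator_self_outer e y
    rwa [associator, sub_eq_zero] at this
  refine ⟨e * (x * e), e * x - e * (x * e), x * e - e * (x * e),
    x - e * x - x * e + e * (x * e), ⟨?_, ?_⟩, ⟨?_, ?_⟩, ⟨?_, ?_⟩, ⟨?_, ?_⟩, ?_⟩ <;>
  simp [mul_sub, sub_mul, mul_add, add_mul, h₁, h₂, h₃]
  abel

theorem eq_zero_of_mul_eq_zero (h : FaithfulSymmIdem e) [IsAddTorsionFree A] {x : A}
    (hx : IsPeirce e 1 1 x) (hr : ∀ r, IsPeirce e 1 0 r → x * r = 0) : x = 0 := by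
  refine h.faithful_compl x fun r => ?_
  obtain ⟨a, b, c, d, ha, hb, hc, hd, rfl⟩ := h.exists_decomp r
  have h₁ := (hx.mul h ha).compl.right
  have h₂ : x * c = 0 := (hx.mul h hc).eq_zero_of_left h (by norm_num) (by norm_num)
  have h₃ : x * d = 0 := (hx.mul h hd).eq_zero_of_left h (by norm_num) (by norm_num)
  simp [mul_add, hr b hb, h₂, h₃, h₁]

end FaithfulSymmIdem

end Peirce

section Derivation

variable {A : Type*} [NonAssocRing A]

/-- The defect of the Leibniz rule. -/
def leibnizDefect (Φ : A → A) (a b : A) : A := Φ (a * b) - Φ a * b - a * Φ b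

/-- The defect of the Leibniz rule for `Φ` on the associator. -/
def associatorDefect (Φ : A → A) (a b c : A) : A :=
  Φ (associator a b c) - associator (Φ a) b c - associator a (Φ b) c - associator a b (Φ c)

variable {e : A} {Φ : A → A}

theorem associatorDefect_eq (hadd : ∀ a b, Φ (a + b) = Φ a + Φ b) (a b c : A) :
    associatorDefect Φ a b c = leibnizDefect Φ (a * b) c + leibnizDefect Φ a b * c -
      leibnizDefect Φ a (b * c) - a * leibnizDefect Φ b c := by
  have hsub : ∀ a b, Φ (a - b) = Φ a - Φ b := (AddMonoidHom.mk' Φ hadd).map_sub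
  simp only [associatorDefect, leibnizDefect, associator, hsub, mul_sub, sub_mul]
  abel

variable [StarRing A]

theorem associatorDefect_swap_left (h : FaithfulSymmIdem e) (hadd : ∀ a b, Φ (a + b) = Φ a + Φ b)
    (a b c : A) : associatorDefect Φ a b c = -associatorDefect Φ b a c := by
  have hneg : ∀ a, Φ (-a) = -Φ a := (AddMonoidHom.mk' Φ hadd).map_neg
  simp only [associatorDefect]
  rw [h.associator_swap_left a b c, h.associator_swap_left (Φ a) b c,
    h.associator_swap_left a (Φ b) c, h.associator_swap_left a b (Φ c), hneg]
  abel

theorem associatorDefect_swap_right (h : FaithfulSymmIdem e) (hadd : ∀ a b, Φ (a + b) = Φ a + Φ b)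
    (a b c : A) : associatorDefect Φ a b c = -associatorDefect Φ a c b := by
  have hneg : ∀ a, Φ (-a) = -Φ a := (AddMonoidHom.mk' Φ hadd).map_neg
  simp only [associatorDefect]
  rw [h.associator_swap_right a b c, h.associator_swap_right (Φ a) b c,
    h.associator_swap_right a (Φ b) c, h.associator_swap_right a b (Φ c), hneg]
  abel

/-- An additive map for which the defect `δ` of the Leibniz rule satisfies
`δ(a, b) + δ(b, a*) = 0`. -/
structure IsStarJordanDer (Φ : A → A) : Prop where
  map_add : ∀ a b, Φ (a + b) = Φ a + Φ b
  defect : ∀ a b, leibnizDefect Φ a b = -leibnizDefect Φ b (star a)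

namespace IsStarJordanDer

theorem defect_add_left (hΦ : IsStarJordanDer Φ) (a b c : A) :
    leibnizDefect Φ (a + b) c = leibnizDefect Φ a c + leibnizDefect Φ b c := by
  simp only [leibnizDefect, hΦ.map_add, add_mul]
  abel

theorem defect_add_right (hΦ : IsStarJordanDer Φ) (c a b : A) :
    leibnizDefect Φ c (a + b) = leibnizDefect Φ c a + leibnizDefect Φ c b := by
  simp only [leibnizDefect, hΦ.map_add, mul_add]
  abel

theorem defect_zsmul_left (hΦ : IsStarJordanDer Φ) (n : ℤ) (a c : A) :
    leibnizDefect Φ (n • a) c = n • leibnizDefect Φ a c :=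
  (AddMonoidHom.mk' (fun x => leibnizDefect Φ x c)
    fun a b => hΦ.defect_add_left a b c).map_zsmul n a

theorem defect_zsmul_right (hΦ : IsStarJordanDer Φ) (n : ℤ) (c a : A) :
    leibnizDefect Φ c (n • a) = n • leibnizDefect Φ c a :=
  (AddMonoidHom.mk' (leibnizDefect Φ c) fun a b => hΦ.defect_add_right c a b).map_zsmul n a

theorem defect_star (hΦ : IsStarJordanDer Φ) (a b : A) :
    leibnizDefect Φ (star a) (star b) = leibnizDefect Φ a b := by
  rw [hΦ.defect a b, hΦ.defect b (star a), neg_neg]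

variable [IsAddTorsionFree A]

theorem defect_idem_left (hΦ : IsStarJordanDer Φ) (h : FaithfulSymmIdem e) (x : A) :
    leibnizDefect Φ e x = 0 := by
  have hsymm : ∀ x, leibnizDefect Φ x e = -leibnizDefect Φ e x := fun x => by
    rw [hΦ.defect e x, h.star_eq, neg_neg]
  have hstar : ∀ x, leibnizDefect Φ e (star x) = leibnizDefect Φ e x := fun x => by
    simpa [h.star_eq] using hΦ.defect_star e x
  have hee : leibnizDefect Φ e e = 0 := self_eq_neg.1 (hsymm e)
  have hE : ∀ x, associatorDefect Φ e e x = 0 := fun x =>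
    self_eq_neg.1 (associatorDefect_swap_left h hΦ.map_add e e x)
  have key : ∀ i j x, IsPeirce e i j x →
      IsPeirce e (1 - i) (2 * i + j - 1) (leibnizDefect Φ e x) := fun i j x hx => by
    have h₁ := hE x
    rw [associatorDefect_eq hΦ.map_add, h.idem, hee, hx.left, hΦ.defect_zsmul_right] at h₁
    have h₂ := hE x
    rw [← neg_eq_zero, ← associatorDefect_swap_right h hΦ.map_add,
      associatorDefect_eq hΦ.map_add, hx.left, hx.right, hΦ.defect_zsmul_right,
      hΦ.defect_zsmul_left, hsymm x] at h₂
    have h₃ : e * leibnizDefect Φ e x = (1 - i) • leibnizDefect Φ e x := by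
      rw [← sub_eq_zero, ← neg_eq_zero, ← h₁, zero_mul]
      module
    refine ⟨h₃, ?_⟩
    rw [mul_neg, h₃] at h₂
    rw [← sub_eq_zero, ← h₂]
    module
  obtain ⟨a, b, c, d, ha, hb, hc, hd, rfl⟩ := h.exists_decomp x
  have h₁ := (key _ _ _ ha).eq_zero_of_right h (by norm_num) (by norm_num)
  have h₂ := (key _ _ _ hb).eq_zero_of_ne (hstar b ▸ key _ _ _ (hb.star h)) (by norm_num)
  have h₃ := (key _ _ _ hc).eq_zero_of_ne (hstar c ▸ key _ _ _ (hc.star h)) (by norm_num)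
  have h₄ := (key _ _ _ hd).eq_zero_of_right h (by norm_num) (by norm_num)
  simp [hΦ.defect_add_right, h₁, h₂, h₃, h₄]

theorem defect_idem_right (hΦ : IsStarJordanDer Φ) (h : FaithfulSymmIdem e) (x : A) :
    leibnizDefect Φ x e = 0 := by
  rw [← neg_eq_zero, ← h.star_eq, ← hΦ.defect, hΦ.defect_idem_left h]

theorem defect_isPeirce (hΦ : IsStarJordanDer Φ) (h : FaithfulSymmIdem e) {i j k l : ℤ} {b c : A}
    (hb : IsPeirce e i j b) (hc : IsPeirce e k l c) :
    IsPeirce e (i + j - k) (k + l - j) (leibnizDefect Φ b c) := by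
  have h₁ := associatorDefect_swap_left h hΦ.map_add e b c
  have h₂ := associatorDefect_swap_right h hΦ.map_add b e c
  simp only [associatorDefect_eq hΦ.map_add, hΦ.defect_idem_left h, hΦ.defect_idem_right h,
    hb.left, hb.right, hc.left, hc.right, hΦ.defect_zsmul_left, hΦ.defect_zsmul_right,
    zero_mul, mul_zero] at h₁ h₂
  constructor
  · rw [← sub_eq_zero] at h₁ ⊢
    rw [← neg_eq_zero, ← h₁]
    module
  · rw [← sub_eq_zero] at h₂ ⊢
    rw [← h₂]
    module

theorem defect_corner (hΦ : IsStarJordanDer Φ) (h : FaithfulSymmIdem e) {b c : A}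
    (hb : IsPeirce e 1 1 b) (hc : IsPeirce e 1 1 c) : leibnizDefect Φ b c = 0 := by
  have hmix : ∀ {b r : A}, IsPeirce e 1 1 b → IsPeirce e 1 0 r →
      leibnizDefect Φ b r = 0 := fun {b r} hb hr =>
    (hΦ.defect_isPeirce h hb hr).eq_zero_of_ne
      (hΦ.defect_star b r ▸ hΦ.defect_isPeirce h (hb.star h) (hr.star h)) (by norm_num)
  have hD := hΦ.defect_isPeirce h hb hc
  norm_num at hD
  refine h.eq_zero_of_mul_eq_zero hD fun r hr => ?_
  have h₁ := associatorDefect_swap_right h hΦ.map_add b c r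
  rw [associatorDefect_swap_left h hΦ.map_add b r c, neg_neg] at h₁
  have hbc := hb.mul h hc
  have hcr := hc.mul h hr
  have hrb : r * b = 0 := (hr.mul h hb).eq_zero_of_right h (by norm_num) (by norm_num)
  have hrD : r * leibnizDefect Φ b c = 0 :=
    (hr.mul h hD).eq_zero_of_right h (by norm_num) (by norm_num)
  have hrb' : leibnizDefect Φ r b = 0 :=
    (hΦ.defect_isPeirce h hr hb).eq_zero_of_right h (by norm_num) (by norm_num)
  have hrbc : leibnizDefect Φ r (b * c) = 0 :=
    (hΦ.defect_isPeirce h hr hbc).eq_zero_of_right h (by norm_num) (by norm_num)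
  have h0 : leibnizDefect Φ 0 c = 0 := by simpa using hΦ.defect_zsmul_left 0 0 c
  norm_num at hbc hcr
  simpa [associatorDefect_eq hΦ.map_add, hmix hbc hr, hmix hb hcr, hmix hc hr, hrb, hrD, hrb',
    hrbc, h0] using h₁

theorem defect_eq_zero (hΦ : IsStarJordanDer Φ) (h : FaithfulSymmIdem e) (x y : A) :
    leibnizDefect Φ x y = 0 := by
  have key : ∀ {i j k l b c}, IsPeirce e i j b → IsPeirce e k l c → (i ≠ j ∨ k ≠ l) →
      leibnizDefect Φ b c = 0 := fun hb hc hne =>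
    (hΦ.defect_isPeirce h hb hc).eq_zero_of_ne
      (hΦ.defect_star _ _ ▸ hΦ.defect_isPeirce h (hb.star h) (hc.star h)) (by omega)
  have hcorner : ∀ {b c : A}, IsPeirce e 0 0 b → IsPeirce e 0 0 c → leibnizDefect Φ b c = 0 :=
    fun hb hc => hΦ.defect_corner h.compl (by simpa using hb.compl) (by simpa using hc.compl)
  obtain ⟨a, b, c, d, ha, hb, hc, hd, rfl⟩ := h.exists_decomp x
  obtain ⟨a', b', c', d', ha', hb', hc', hd', rfl⟩ := h.exists_decomp y
  have had : leibnizDefect Φ a d' = 0 :=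
    (hΦ.defect_isPeirce h ha hd').eq_zero_of_left h (by norm_num) (by norm_num)
  have hda : leibnizDefect Φ d a' = 0 :=
    (hΦ.defect_isPeirce h hd ha').eq_zero_of_left h (by norm_num) (by norm_num)
  simp only [hΦ.defect_add_left, hΦ.defect_add_right, hΦ.defect_corner h ha ha', hcorner hd hd',
    had, hda, key ha hb' (by decide), key ha hc' (by decide), key hb ha' (by decide),
    key hb hb' (by decide), key hb hc' (by decide), key hb hd' (by decide),
    key hc ha' (by decide), key hc hb' (by decide), key hc hc' (by decide),
    key hc hd' (by decide), key hd hb' (by decide), key hd hc' (by decide), add_zero]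

end IsStarJordanDer

end Derivation

section Additivity

variable {A : Type*} [NonAssocRing A]

/-- The defect of additivity. -/
def addDefect (Φ : A → A) (a b : A) : A := Φ (a + b) - Φ a - Φ b

theorem eq_zero_of_add_self [IsAddTorsionFree A] {x : A} (hx : x + x = 0) : x = 0 := by
  rw [← two_nsmul, smul_eq_zero] at hx
  exact hx.resolve_left two_ne_zero

variable [StarRing A] {e : A} {Φ : A → A}

theorem starJordan_zero (x : A) : starJordan x 0 = 0 := by simp [starJordan]

theorem zero_starJordan (x : A) : starJordan 0 x = 0 := by simp [starJordan]

theorem starJordan_add (x y z : A) : starJordan x (y + z) = starJordan x y + starJordan x z := by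
  simp only [starJordan, mul_add, add_mul]
  abel

theorem add_starJordan (x y z : A) : starJordan (x + y) z = starJordan x z + starJordan y z := by
  simp only [starJordan, mul_add, add_mul, star_add]
  abel

theorem IsPeirce.starJordan_left (h : FaithfulSymmIdem e) {i j : ℤ} {x : A}
    (hx : IsPeirce e i j x) : starJordan e x = (i + j) • x := by
  rw [starJordan, h.star_eq, hx.left, hx.right, add_smul]

theorem IsPeirce.starJordan_compl_left (h : FaithfulSymmIdem e) {i j : ℤ} {x : A}
    (hx : IsPeirce e i j x) : starJordan (1 - e) x = (2 - i - j) • x := by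
  rw [hx.compl.starJordan_left h.compl]
  module

theorem IsPeirce.starJordan_right (h : FaithfulSymmIdem e) {i j : ℤ} {x : A}
    (hx : IsPeirce e i j x) : starJordan x e = j • (x + star x) := by
  rw [starJordan, hx.right, (hx.star h).left, smul_add]

theorem IsPeirce.starJordan_left₁₁ (h : FaithfulSymmIdem e) {x : A} (hx : IsPeirce e 1 1 x) :
    starJordan e x = x + x := by
  rw [hx.starJordan_left h]
  module

theorem IsPeirce.starJordan_left₁₂ (h : FaithfulSymmIdem e) {x : A} (hx : IsPeirce e 1 0 x) :
    starJordan e x = x := by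
  rw [hx.starJordan_left h]
  module

theorem IsPeirce.starJordan_left₂₁ (h : FaithfulSymmIdem e) {x : A} (hx : IsPeirce e 0 1 x) :
    starJordan e x = x := by
  rw [hx.starJordan_left h]
  module

theorem IsPeirce.starJordan_left₂₂ (h : FaithfulSymmIdem e) {x : A} (hx : IsPeirce e 0 0 x) :
    starJordan e x = 0 := by
  rw [hx.starJordan_left h]
  module

theorem IsPeirce.starJordan_compl_left₁₁ (h : FaithfulSymmIdem e) {x : A}
    (hx : IsPeirce e 1 1 x) : starJordan (1 - e) x = 0 := by
  rw [hx.starJordan_compl_left h]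
  module

theorem IsPeirce.starJordan_compl_left₁₂ (h : FaithfulSymmIdem e) {x : A}
    (hx : IsPeirce e 1 0 x) : starJordan (1 - e) x = x := by
  rw [hx.starJordan_compl_left h]
  module

theorem IsPeirce.starJordan_compl_left₂₁ (h : FaithfulSymmIdem e) {x : A}
    (hx : IsPeirce e 0 1 x) : starJordan (1 - e) x = x := by
  rw [hx.starJordan_compl_left h]
  module

theorem IsPeirce.starJordan_compl_left₂₂ (h : FaithfulSymmIdem e) {x : A}
    (hx : IsPeirce e 0 0 x) : starJordan (1 - e) x = x + x := by
  rw [hx.starJordan_compl_left h]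
  module

namespace FaithfulSymmIdem

theorem exists_offDiagonal (h : FaithfulSymmIdem e) {x : A} (hx : starJordan e x = x) :
    ∃ b c, IsPeirce e 1 0 b ∧ IsPeirce e 0 1 c ∧ x = b + c := by
  obtain ⟨a, b, c, d, ha, hb, hc, hd, rfl⟩ := h.exists_decomp x
  simp only [starJordan_add, ha.starJordan_left₁₁ h, hb.starJordan_left₁₂ h,
    hc.starJordan_left₂₁ h, hd.starJordan_left₂₂ h] at hx
  have hs : a + 0 + 0 + -d = 0 := by
    refine Eq.trans ?_ (sub_eq_zero.2 hx)
    abel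
  obtain ⟨rfl, -, -, hd₀⟩ := IsPeirce.components_eq_zero ha (IsPeirce.zero e 1 0)
    (IsPeirce.zero e 0 1) (by simpa using hd.zsmul (-1)) hs
  exact ⟨b, c, hb, hc, by rw [neg_eq_zero.1 hd₀, zero_add, add_zero]⟩

variable [IsAddTorsionFree A]

theorem isPeirce_of_starJordan_compl (h : FaithfulSymmIdem e) {x : A}
    (hx : starJordan (1 - e) x = 0) : IsPeirce e 1 1 x := by
  obtain ⟨a, b, c, d, ha, hb, hc, hd, rfl⟩ := h.exists_decomp x
  simp only [starJordan_add, ha.starJordan_compl_left₁₁ h, hb.starJordan_compl_left₁₂ h,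
    hc.starJordan_compl_left₂₁ h, hd.starJordan_compl_left₂₂ h] at hx
  obtain ⟨-, rfl, rfl, h₂⟩ := IsPeirce.components_eq_zero (IsPeirce.zero e 1 1) hb hc
    (hd.add hd) hx
  rw [eq_zero_of_add_self h₂]
  simpa using ha

end FaithfulSymmIdem

/-- A map satisfying the Leibniz rule for the product `•`. -/
def IsStarJordanMap (Φ : A → A) : Prop :=
  ∀ x y, Φ (starJordan x y) = starJordan (Φ x) y + starJordan x (Φ y)

namespace IsStarJordanMap

theorem map_zero (hΦ : IsStarJordanMap Φ) : Φ 0 = 0 := by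
  simpa [starJordan_zero, zero_starJordan] using hΦ 0 0

theorem addDefect_zero_left (hΦ : IsStarJordanMap Φ) (x : A) : addDefect Φ 0 x = 0 := by
  simp [addDefect, hΦ.map_zero]

theorem addDefect_zero_right (hΦ : IsStarJordanMap Φ) (x : A) : addDefect Φ x 0 = 0 := by
  simp [addDefect, hΦ.map_zero]

theorem starJordan_addDefect (hΦ : IsStarJordanMap Φ) (x a b : A) :
    starJordan x (addDefect Φ a b) = addDefect Φ (starJordan x a) (starJordan x b) := by
  simp only [addDefect, ← starJordan_add, hΦ x]
  simp only [starJordan, mul_add, mul_sub, add_mul, sub_mul]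
  abel

theorem addDefect_starJordan (hΦ : IsStarJordanMap Φ) (a b y : A) :
    starJordan (addDefect Φ a b) y = addDefect Φ (starJordan a y) (starJordan b y) := by
  simp only [addDefect, ← add_starJordan, hΦ _ y]
  simp only [starJordan, mul_add, mul_sub, add_mul, sub_mul, star_add, star_sub]
  abel

theorem exists_addDefect_diagonal (hΦ : IsStarJordanMap Φ) (h : FaithfulSymmIdem e) {a b c d : A}
    (ha : IsPeirce e 1 1 a) (hb : IsPeirce e 1 0 b) (hc : IsPeirce e 0 1 c)
    (hd : IsPeirce e 0 0 d) :
    ∃ x y, IsPeirce e 1 1 x ∧ IsPeirce e 0 0 y ∧ addDefect Φ (a + d) (b + c) = x + y := by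
  have h₁ := hΦ.starJordan_addDefect e (a + d) (b + c)
  have h₂ := hΦ.starJordan_addDefect (1 - e) (starJordan e (a + d)) (starJordan e (b + c))
  rw [← h₁] at h₂
  simp only [starJordan_add, ha.starJordan_left₁₁ h, hb.starJordan_left₁₂ h,
    hc.starJordan_left₂₁ h, hd.starJordan_left₂₂ h,
    ha.starJordan_compl_left₁₁ h, add_zero, hΦ.addDefect_zero_left] at h₂
  obtain ⟨x, p, q, y, hx, hp, hq, hy, hs⟩ := h.exists_decomp (addDefect Φ (a + d) (b + c))
  simp only [hs, starJordan_add, hx.starJordan_left₁₁ h, hp.starJordan_left₁₂ h,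
    hq.starJordan_left₂₁ h, hy.starJordan_left₂₂ h,
    hx.starJordan_compl_left₁₁ h, hp.starJordan_compl_left₁₂ h,
    hq.starJordan_compl_left₂₁ h, add_zero, zero_add] at h₂
  obtain ⟨-, rfl, rfl, -⟩ := IsPeirce.components_eq_zero (IsPeirce.zero e 1 1) hp hq
    (IsPeirce.zero e 0 0) (by rw [zero_add, add_zero, h₂])
  exact ⟨x, y, hx, hy, by rw [hs, add_zero, add_zero]⟩

theorem addDefect_offDiagonal (hΦ : IsStarJordanMap Φ) (h : FaithfulSymmIdem e) {b c : A}
    (hb : IsPeirce e 1 0 b) (hc : IsPeirce e 0 1 c) : addDefect Φ b c = 0 := by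
  have h₁ := hΦ.starJordan_addDefect e b c
  rw [hb.starJordan_left₁₂ h, hc.starJordan_left₂₁ h] at h₁
  have h₂ := hΦ.addDefect_starJordan b c e
  have h₃ := hΦ.addDefect_starJordan b c (1 - e)
  obtain ⟨x, y, hx, hy, hxy⟩ := h.exists_offDiagonal h₁
  rw [hb.starJordan_right h, zero_smul, hΦ.addDefect_zero_left, hxy, add_starJordan,
    hx.starJordan_right h, hy.starJordan_right h, zero_smul, zero_add, one_smul] at h₂
  rw [hc.compl.starJordan_right h.compl, sub_self, zero_smul, hΦ.addDefect_zero_right, hxy,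
    add_starJordan, hx.compl.starJordan_right h.compl, hy.compl.starJordan_right h.compl,
    sub_self, zero_smul, add_zero, sub_zero, one_smul] at h₃
  obtain ⟨-, -, rfl, -⟩ := IsPeirce.components_eq_zero (IsPeirce.zero e 1 1) (hy.star h) hy
    (IsPeirce.zero e 0 0) (by rw [zero_add, add_zero, add_comm, h₂])
  obtain ⟨-, rfl, -, -⟩ := IsPeirce.components_eq_zero (IsPeirce.zero e 1 1) hx (hx.star h)
    (IsPeirce.zero e 0 0) (by rw [zero_add, add_zero, h₃])
  rw [hxy, add_zero]

theorem isPeirce_addDefect (hΦ : IsStarJordanMap Φ) (h : FaithfulSymmIdem e) {b c : A}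
    (hb : IsPeirce e 1 0 b) (hc : IsPeirce e 1 0 c) : IsPeirce e 1 0 (addDefect Φ b c) := by
  have h₁ := hΦ.starJordan_addDefect e b c
  rw [hb.starJordan_left₁₂ h, hc.starJordan_left₁₂ h] at h₁
  have h₂ := hΦ.addDefect_starJordan b c e
  obtain ⟨x, y, hx, hy, hxy⟩ := h.exists_offDiagonal h₁
  rw [hb.starJordan_right h, zero_smul, hΦ.addDefect_zero_left, hxy, add_starJordan,
    hx.starJordan_right h, hy.starJordan_right h, zero_smul, zero_add, one_smul] at h₂
  obtain ⟨-, -, rfl, -⟩ := IsPeirce.components_eq_zero (IsPeirce.zero e 1 1) (hy.star h) hy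
    (IsPeirce.zero e 0 0) (by rw [zero_add, add_zero, add_comm, h₂])
  rwa [hxy, add_zero]

variable [IsAddTorsionFree A]

theorem addDefect_corner_offDiagonal (hΦ : IsStarJordanMap Φ) (h : FaithfulSymmIdem e)
    {a b c : A} (ha : IsPeirce e 1 1 a) (hb : IsPeirce e 1 0 b) (hc : IsPeirce e 0 1 c) :
    addDefect Φ a (b + c) = 0 := by
  have hT : IsPeirce e 1 1 (addDefect Φ a (b + c)) := by
    apply h.isPeirce_of_starJordan_compl
    rw [hΦ.starJordan_addDefect, ha.starJordan_compl_left₁₁ h, hΦ.addDefect_zero_left]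
  refine h.eq_zero_of_mul_eq_zero hT fun r hr => ?_
  have hmul : ∀ {x}, IsPeirce e 1 1 x → starJordan x r = x * r := fun {x} hx => by
    rw [starJordan, (hr.mul h (hx.star h)).eq_zero_of_right h (by norm_num) (by norm_num),
      add_zero]
  have hz := ha.mul h hr
  have hbr := hb.mul h hr
  have hrb := hr.mul h (hb.star h)
  have hcr := hc.mul h hr
  have hrc := hr.mul h (hc.star h)
  have hTr := hT.mul h hr
  norm_num at hz hbr hrb hcr hrc hTr
  obtain ⟨x, y, hx, hy, hxy⟩ := hΦ.exists_addDefect_diagonal h hrb hz (hbr.add hrc) hcr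
  obtain ⟨x', y', hx', hy', hxy'⟩ :=
    hΦ.exists_addDefect_diagonal h hrb (IsPeirce.zero e 1 0) (hbr.add hrc) hcr
  have hzq := hΦ.addDefect_offDiagonal h hz (hbr.add hrc)
  have h₁ := hΦ.addDefect_starJordan a (b + c) r
  rw [hmul hT, hmul ha] at h₁
  have h₂ : addDefect Φ (a * r) (starJordan (b + c) r) = x + y - (x' + y') := by
    rw [← hxy, ← hxy']
    have e₁ : a * r + starJordan (b + c) r =
        r * star b + c * r + (a * r + (b * r + r * star c)) := by
      simp only [starJordan, add_mul, mul_add, star_add]; abel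
    have e₂ : starJordan (b + c) r = r * star b + c * r + (0 + (b * r + r * star c)) := by
      simp only [starJordan, add_mul, mul_add, star_add]; abel
    simp only [addDefect, sub_sub, sub_eq_zero] at hzq ⊢
    rw [e₁, e₂, hzq, zero_add]
    abel
  rw [h₂] at h₁
  refine (IsPeirce.components_eq_zero (hx'.add (hx.zsmul (-1))) hTr (IsPeirce.zero e 0 1)
    (hy'.add (hy.zsmul (-1))) ?_).2.1
  rw [h₁]
  module

theorem addDefect_diagonal_offDiagonal (hΦ : IsStarJordanMap Φ) (h : FaithfulSymmIdem e)
    {a b c d : A} (ha : IsPeirce e 1 1 a) (hb : IsPeirce e 1 0 b) (hc : IsPeirce e 0 1 c)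
    (hd : IsPeirce e 0 0 d) : addDefect Φ (a + d) (b + c) = 0 := by
  have hcompl : ∀ {x}, IsPeirce e 0 0 x → addDefect Φ x (b + c) = 0 := fun {x} hx => by
    rw [add_comm]
    exact hΦ.addDefect_corner_offDiagonal h.compl hx.compl₂₂
      hc.compl₂₁ hb.compl₁₂
  have h₁ := hΦ.starJordan_addDefect e (a + d) (b + c)
  have h₂ := hΦ.starJordan_addDefect (1 - e) (a + d) (b + c)
  rw [starJordan_add, starJordan_add, ha.starJordan_left₁₁ h, hb.starJordan_left₁₂ h,
    hc.starJordan_left₂₁ h, hd.starJordan_left₂₂ h, add_zero,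
    hΦ.addDefect_corner_offDiagonal h (ha.add ha) hb hc] at h₁
  rw [starJordan_add _ a, starJordan_add _ b, ha.starJordan_compl_left₁₁ h,
    hb.starJordan_compl_left₁₂ h, hc.starJordan_compl_left₂₁ h, hd.starJordan_compl_left₂₂ h,
    zero_add, hcompl (hd.add hd)] at h₂
  rw [(h.isPeirce_of_starJordan_compl h₂).starJordan_left₁₁ h] at h₁
  exact eq_zero_of_add_self h₁

theorem addDefect_offDiagonal_same (hΦ : IsStarJordanMap Φ) (h : FaithfulSymmIdem e) {b c : A}
    (hb : IsPeirce e 1 0 b) (hc : IsPeirce e 1 0 c) : addDefect Φ b c = 0 := by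
  have hbc := hb.mul h hc
  have hcb := hc.mul h (hb.star h)
  norm_num at hbc hcb
  have he : IsPeirce e 1 1 e := ⟨by simp [h.idem], by simp [h.idem]⟩
  have hf : IsPeirce e 0 0 (1 - e) :=
    ⟨by simp [mul_sub, h.idem], by simp [sub_mul, h.idem]⟩
  have h₁ := hΦ (e + b) (1 - e + c)
  have hz : ∀ {i j}, IsPeirce e i j 0 := fun {i j} => IsPeirce.zero e i j
  have e₁ := hΦ.addDefect_diagonal_offDiagonal h he hb hz hz
  have e₂ := hΦ.addDefect_diagonal_offDiagonal h hz hc hz hf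
  have e₃ := hΦ.addDefect_diagonal_offDiagonal h hcb (hb.add hc) ((hb.star h).add hbc) hz
  have e₄ := hΦ.addDefect_diagonal_offDiagonal h hcb hz hbc hz
  have e₅ := hΦ.addDefect_offDiagonal h (hb.add hc) ((hb.star h).add hbc)
  have e₆ := hΦ.addDefect_offDiagonal h hb (hb.star h)
  have hp := hΦ.isPeirce_addDefect h hb hc
  have hq := hΦ.isPeirce_addDefect h.compl (hb.star h).compl₂₁
    hbc.compl₂₁
  have hq' := hq.compl
  simp only [sub_sub_cancel, sub_self, sub_zero] at hq'
  have j₁ := hΦ e (1 - e)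
  have j₂ := hΦ e c
  have j₃ := hΦ b (1 - e)
  have j₄ := hΦ b c
  have s₁ : starJordan e (1 - e) = 0 := by simp [hf.starJordan_left h]
  have s₂ : starJordan e c = c := by simp [hc.starJordan_left h]
  have s₃ : starJordan b (1 - e) = b + star b := by
    simp [hb.compl.starJordan_right h.compl]
  have s₄ : starJordan b c = b * c + c * star b := rfl
  refine (IsPeirce.components_eq_zero hz hp hq' hz ?_).2.1
  simp only [addDefect, add_zero, zero_add, sub_sub, sub_eq_zero] at e₁ e₂ e₃ e₄ e₅ e₆
  rw [e₁, e₂] at h₁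
  simp only [add_starJordan, starJordan_add, s₁, s₂, s₃] at h₁
  rw [s₁, hΦ.map_zero] at j₁
  rw [s₂] at j₂
  rw [s₃, e₆] at j₃
  rw [s₄, add_comm, e₄] at j₄
  have h₂ : 0 + (b + star b) + (c + starJordan b c) =
      c * star b + (b + c + (star b + b * c)) := by rw [s₄]; abel
  rw [h₂, e₃, e₅] at h₁
  have h₃ : Φ (c * star b) + (Φ (b + c) + Φ (star b + b * c)) =
      0 + (Φ b + Φ (star b)) + (Φ c + (Φ (c * star b) + Φ (b * c))) := by
    refine h₁.trans (Eq.trans ?_ (congrArg₂ (· + ·) (congrArg₂ (· + ·) j₁ j₃)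
      (congrArg₂ (· + ·) j₂ j₄)).symm)
    abel
  refine Eq.trans ?_ (sub_eq_zero.2 h₃)
  simp only [addDefect]
  abel
theorem addDefect_corner (hΦ : IsStarJordanMap Φ) (h : FaithfulSymmIdem e) {a b : A}
    (ha : IsPeirce e 1 1 a) (hb : IsPeirce e 1 1 b) : addDefect Φ a b = 0 := by
  have hT : IsPeirce e 1 1 (addDefect Φ a b) := by
    apply h.isPeirce_of_starJordan_compl
    rw [hΦ.starJordan_addDefect, ha.starJordan_compl_left₁₁ h, hΦ.addDefect_zero_left]
  refine h.eq_zero_of_mul_eq_zero hT fun r hr => ?_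
  have hmul : ∀ {x}, IsPeirce e 1 1 x → starJordan x r = x * r := fun {x} hx => by
    rw [starJordan, (hr.mul h (hx.star h)).eq_zero_of_right h (by norm_num) (by norm_num),
      add_zero]
  rw [← hmul hT, hΦ.addDefect_starJordan, hmul ha, hmul hb]
  exact hΦ.addDefect_offDiagonal_same h (by simpa using ha.mul h hr) (by simpa using hb.mul h hr)

theorem addDefect_diagonal (hΦ : IsStarJordanMap Φ) (h : FaithfulSymmIdem e) {a d : A}
    (ha : IsPeirce e 1 1 a) (hd : IsPeirce e 0 0 d) : addDefect Φ a d = 0 := by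
  have h₁ := hΦ.starJordan_addDefect e a d
  have h₂ := hΦ.starJordan_addDefect (1 - e) a d
  rw [hd.starJordan_left₂₂ h, hΦ.addDefect_zero_right] at h₁
  rw [ha.starJordan_compl_left₁₁ h, hΦ.addDefect_zero_left] at h₂
  rw [(h.isPeirce_of_starJordan_compl h₂).starJordan_left₁₁ h] at h₁
  exact eq_zero_of_add_self h₁

/-- A map satisfying the Leibniz rule for `•` is additive. -/
theorem map_add (hΦ : IsStarJordanMap Φ) (h : FaithfulSymmIdem e) (x y : A) :
    Φ (x + y) = Φ x + Φ y := by
  have hsum : ∀ {a b c d}, IsPeirce e 1 1 a → IsPeirce e 1 0 b → IsPeirce e 0 1 c →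
      IsPeirce e 0 0 d → Φ (a + b + c + d) = Φ a + Φ b + Φ c + Φ d := by
    intro a b c d ha hb hc hd
    have h₁ := hΦ.addDefect_diagonal_offDiagonal h ha hb hc hd
    have h₂ := hΦ.addDefect_diagonal h ha hd
    have h₃ := hΦ.addDefect_offDiagonal h hb hc
    simp only [addDefect, sub_sub, sub_eq_zero] at h₁ h₂ h₃
    rw [show a + b + c + d = a + d + (b + c) by abel, h₁, h₂, h₃]
    abel
  obtain ⟨a, b, c, d, ha, hb, hc, hd, rfl⟩ := h.exists_decomp x
  obtain ⟨a', b', c', d', ha', hb', hc', hd', rfl⟩ := h.exists_decomp y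
  have h₁ := hΦ.addDefect_corner h ha ha'
  have h₂ := hΦ.addDefect_offDiagonal_same h hb hb'
  have h₃ := hΦ.addDefect_offDiagonal_same h.compl hc.compl₂₁ hc'.compl₂₁
  have h₄ := hΦ.addDefect_corner h.compl hd.compl₂₂ hd'.compl₂₂
  simp only [addDefect, sub_sub, sub_eq_zero] at h₁ h₂ h₃ h₄
  rw [show a + b + c + d + (a' + b' + c' + d') = a + a' + (b + b') + (c + c') + (d + d') by abel,
    hsum (ha.add ha') (hb.add hb') (hc.add hc') (hd.add hd'), hsum ha hb hc hd,
    hsum ha' hb' hc' hd', h₁, h₂, h₃, h₄]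
  abel

theorem map_star (hΦ : IsStarJordanMap Φ) (h : FaithfulSymmIdem e) (h1 : Φ 1 = 0) (x : A) :
    Φ (star x) = star (Φ x) := by
  have h₁ := hΦ x 1
  simp only [h1, starJordan, mul_one, one_mul, mul_zero, zero_mul, add_zero,
    hΦ.map_add h] at h₁
  exact add_left_cancel h₁

theorem isStarJordanDer (hΦ : IsStarJordanMap Φ) (h : FaithfulSymmIdem e) (h1 : Φ 1 = 0) :
    IsStarJordanDer Φ where
  map_add := hΦ.map_add h
  defect a b := by
    have h₁ := hΦ a b
    simp only [starJordan, hΦ.map_add h] at h₁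
    rw [← sub_eq_zero] at h₁ ⊢
    refine Eq.trans ?_ h₁
    simp only [leibnizDefect, hΦ.map_star h h1]
    abel

end IsStarJordanMap

end Additivity

section Scaled

variable {A : Type*} [NonAssocRing A] [StarRing A] {e v : A} {Φ : A → A} {N : ℤ}

theorem starJordan_zsmul (n : ℤ) (x y : A) : starJordan x (n • y) = n • starJordan x y := by
  simp only [starJordan, mul_smul_comm, smul_mul_assoc, smul_add]

theorem zsmul_starJordan (n : ℤ) (x y : A) : starJordan (n • x) y = n • starJordan x y := by
  simp only [starJordan, mul_smul_comm, smul_mul_assoc, smul_add, star_zsmul]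

theorem one_starJordan (x : A) : starJordan 1 x = x + x := by
  simp [starJordan]

theorem starJordan_one (x : A) : starJordan x 1 = x + star x := by
  simp [starJordan]

/-- The identity satisfied by a `*`-Jordan `n`-derivation when all but the last two arguments are
equal to `1`. -/
structure IsScaledStarJordanMap (Φ : A → A) (N : ℤ) (v : A) : Prop where
  ne_zero : N ≠ 0
  map_zsmul : ∀ x y, Φ (N • starJordan x y) =
    starJordan (starJordan v x) y + N • (starJordan (Φ x) y + starJordan x (Φ y))

namespace IsScaledStarJordanMap

theorem map_zero (hΦ : IsScaledStarJordanMap Φ N v) : Φ 0 = 0 := by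
  simpa [starJordan_zero, zero_starJordan] using hΦ.map_zsmul 0 0

variable [IsAddTorsionFree A]

theorem cancel (hΦ : IsScaledStarJordanMap Φ N v) {x : A} (hx : N • x = 0) : x = 0 :=
  (smul_eq_zero.1 hx).resolve_left hΦ.ne_zero

theorem starJordan_map_one_sub (hΦ : IsScaledStarJordanMap Φ N v) (h : FaithfulSymmIdem e) :
    starJordan e (Φ 1 - Φ e - Φ (1 - e)) = 0 := by
  have he : IsPeirce e 1 1 e := ⟨by simp [h.idem], by simp [h.idem]⟩
  have hf : IsPeirce e 0 0 (1 - e) :=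
    ⟨by simp [mul_sub, h.idem], by simp [sub_mul, h.idem]⟩
  have h₁ := hΦ.map_zsmul e 1
  have h₂ := hΦ.map_zsmul e e
  have h₃ := hΦ.map_zsmul e (1 - e)
  rw [hf.starJordan_left₂₂ h, smul_zero, hΦ.map_zero] at h₃
  rw [starJordan_one, h.star_eq, ← he.starJordan_left₁₁ h, h₂] at h₁
  apply hΦ.cancel
  rw [← sub_eq_zero] at h₁ h₃
  have h₄ : ∀ x y : A, starJordan x (y - e) = starJordan x y - starJordan x e := fun x y => by
    rw [eq_sub_iff_add_eq, ← starJordan_add, sub_add_cancel]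
  have h₅ : starJordan e (Φ 1 - Φ e - Φ (1 - e)) =
      starJordan e (Φ 1) - starJordan e (Φ e) - starJordan e (Φ (1 - e)) := by
    rw [eq_sub_iff_add_eq, ← starJordan_add, eq_sub_iff_add_eq, ← starJordan_add]
    congr 1
    abel
  rw [h₅]
  simp only [h₄] at h₁ h₃
  have h₆ := congrArg₂ (· - ·) h₃ h₁
  simp only [sub_zero] at h₆
  refine Eq.trans ?_ h₆
  module

theorem map_idem_add (hΦ : IsScaledStarJordanMap Φ N v) (h : FaithfulSymmIdem e) :
    Φ 1 = Φ e + Φ (1 - e) := by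
  have h₁ := hΦ.starJordan_map_one_sub h
  have h₂ := hΦ.starJordan_map_one_sub h.compl
  rw [sub_sub_cancel, sub_right_comm] at h₂
  have h₃ := add_starJordan e (1 - e) (Φ 1 - Φ e - Φ (1 - e))
  rw [h₁, h₂, add_sub_cancel, one_starJordan, add_zero] at h₃
  rw [← sub_eq_zero, ← sub_sub]
  exact eq_zero_of_add_self h₃

theorem map_idem (hΦ : IsScaledStarJordanMap Φ N v) (h : FaithfulSymmIdem e)
    {a b c d p q r s : A} (ha : IsPeirce e 1 1 a) (hb : IsPeirce e 1 0 b) (hc : IsPeirce e 0 1 c)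
    (hd : IsPeirce e 0 0 d) (hu : Φ 1 = a + b + c + d) (hp : IsPeirce e 1 1 p)
    (hq : IsPeirce e 1 0 q) (hr : IsPeirce e 0 1 r) (hs : IsPeirce e 0 0 s)
    (hv : v = p + q + r + s) :
    (∃ x y z, IsPeirce e 1 1 x ∧ IsPeirce e 1 0 y ∧ IsPeirce e 0 1 z ∧ Φ e = x + y + z) ∧
      N • c + star q = 0 := by
  have he : IsPeirce e 1 1 e := ⟨by simp [h.idem], by simp [h.idem]⟩
  have right₁ : ∀ {i x}, IsPeirce e i 1 x → starJordan x e = x + star x := fun {i x} hx => by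
    rw [hx.starJordan_right h, one_smul]
  have right₀ : ∀ {i x}, IsPeirce e i 0 x → starJordan x e = 0 := fun {i x} hx => by
    rw [hx.starJordan_right h, zero_smul]
  obtain ⟨x, y, z, w, hx, hy, hz, hw, hA⟩ := h.exists_decomp (Φ e)
  have h₁ := hΦ.map_zsmul 1 e
  rw [one_starJordan, ← he.starJordan_left₁₁ h, hΦ.map_zsmul e e, hA, hu, hv] at h₁
  simp only [starJordan_add, add_starJordan, one_starJordan, starJordan_one, star_add,
    right₁ ha, right₀ hb, right₁ hc, right₀ hd, right₁ hp, right₀ hq, right₁ hr, right₀ hs,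
    right₁ hx, right₀ hy, right₁ hz, right₀ hw, right₁ (hp.star h), right₁ (hq.star h),
    right₀ (hr.star h), right₀ (hs.star h), hx.starJordan_left₁₁ h, hy.starJordan_left₁₂ h,
    hz.starJordan_left₂₁ h, hw.starJordan_left₂₂ h, star_star, zero_starJordan] at h₁
  have hx' := hx.star h
  have ha' := ha.star h
  rw [← sub_eq_zero] at h₁
  obtain ⟨-, -, h₂, h₃⟩ := IsPeirce.components_eq_zero
    (((hx.add hx').add ((ha.add ha').zsmul (-1))).zsmul N)
    (((((hz.star h).add (hy.zsmul (-1))).add ((hc.star h).zsmul (-1))).zsmul N).add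
      (hq.zsmul (-1)))
    (((hc.zsmul N).add (hq.star h)).zsmul (-1)) ((hw.add hw).zsmul (-N)) (by
      refine Eq.trans ?_ h₁
      module)
  rw [smul_eq_zero] at h₂ h₃
  have hw₀ := eq_zero_of_add_self (h₃.resolve_left (neg_ne_zero.2 hΦ.ne_zero))
  exact ⟨⟨x, y, z, hx, hy, hz, by rw [hA, hw₀, add_zero]⟩, h₂.resolve_left (by norm_num)⟩

/-- Homogeneity on the off-diagonal part. -/
theorem map_two_zsmul_offDiagonal (hΦ : IsScaledStarJordanMap Φ N v) (h : FaithfulSymmIdem e)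
    {x : A} (hx : starJordan e x = x) : Φ ((2 : ℤ) • x) = (2 : ℤ) • Φ x := by
  have key : ∀ {x}, starJordan e x = x → (2 : ℤ) • Φ (N • x) =
      starJordan (starJordan v 1) x + N • (starJordan (Φ 1) x + (2 : ℤ) • Φ x) := by
    intro x hx
    have hx' : starJordan (1 - e) x = x := by
      have h₁ := add_starJordan e (1 - e) x
      rw [add_sub_cancel, one_starJordan, hx] at h₁
      exact (add_left_cancel h₁).symm
    have h₁ := hΦ.map_zsmul e x
    have h₂ := hΦ.map_zsmul (1 - e) x
    rw [hx] at h₁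
    rw [hx'] at h₂
    have h₃ : starJordan (starJordan v e) x + starJordan (starJordan v (1 - e)) x =
        starJordan (starJordan v 1) x := by
      rw [← add_starJordan, ← starJordan_add, add_sub_cancel]
    have h₄ : starJordan e (Φ x) + starJordan (1 - e) (Φ x) = (2 : ℤ) • Φ x := by
      rw [← add_starJordan, add_sub_cancel, one_starJordan, two_zsmul]
    rw [two_zsmul, ← h₃, ← h₄, hΦ.map_idem_add h, add_starJordan]
    nth_rw 1 [h₁]
    rw [h₂]
    module
  have h₁ := key hx
  have h₂ := hΦ.map_zsmul 1 x
  have h₃ := key (x := (2 : ℤ) • x) (by rw [starJordan_zsmul, hx])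
  simp only [one_starJordan, ← two_zsmul] at h₂
  rw [← h₁] at h₂
  rw [h₂, h₁, starJordan_zsmul, starJordan_zsmul, ← sub_eq_zero] at h₃
  have h₄ : (2 : ℤ) • N • (Φ ((2 : ℤ) • x) - (2 : ℤ) • Φ x) = 0 := by
    rw [← neg_eq_zero]
    refine Eq.trans ?_ h₃
    module
  exact sub_eq_zero.1 (hΦ.cancel ((smul_eq_zero.1 h₄).resolve_left two_ne_zero))

theorem map_pow_zsmul_offDiagonal (hΦ : IsScaledStarJordanMap Φ N v) (h : FaithfulSymmIdem e)
    {x : A} (hx : starJordan e x = x) (k : ℕ) : Φ ((2 ^ k : ℤ) • x) = (2 ^ k : ℤ) • Φ x := by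
  induction k with
  | zero => simp
  | succ k ih =>
    rw [pow_succ', mul_smul, mul_smul, ← ih,
      hΦ.map_two_zsmul_offDiagonal h (by rw [starJordan_zsmul, hx])]

theorem map_one_offDiagonal (hΦ : IsScaledStarJordanMap Φ N v) (h : FaithfulSymmIdem e)
    {α β : ℤ} (hα : 0 ≤ α) (hβ : 0 ≤ β) (hβN : β < N)
    (hv : v = α • (Φ 1 + star (Φ 1)) + β • Φ 1) {a b c d : A} (ha : IsPeirce e 1 1 a)
    (hb : IsPeirce e 1 0 b) (hc : IsPeirce e 0 1 c) (hd : IsPeirce e 0 0 d)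
    (hu : Φ 1 = a + b + c + d) : b = 0 := by
  have hp := ((ha.add (ha.star h)).zsmul α).add (ha.zsmul β)
  have hq := ((hb.add (hc.star h)).zsmul α).add (hb.zsmul β)
  have hr := ((hc.add (hb.star h)).zsmul α).add (hc.zsmul β)
  have hs := ((hd.add (hd.star h)).zsmul α).add (hd.zsmul β)
  have h₁ := (hΦ.map_idem h ha hb hc hd hu hp hq hr hs (by
    rw [hv, hu]
    simp only [star_add]
    module)).2
  have h₂ := (hΦ.map_idem h.compl (a := d) (b := c) (c := b) (d := a) hd.compl₂₂
    hc.compl₂₁ hb.compl₁₂ ha.compl₁₁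
    (by rw [hu]; abel) hs.compl₂₂ hr.compl₂₁
    hq.compl₁₂ hp.compl₁₁ (by
      rw [hv, hu]
      simp only [star_add]
      module)).2
  have h₃ := congrArg star h₁
  simp only [star_add, star_zsmul, star_star, star_zero] at h₂ h₃
  have h₄ : ((N - β) * (N + 2 * α + β)) • b = 0 := by
    have h₅ := congrArg₂ (fun x y => (N + α) • x - (α + β) • y) h₂ h₃
    simp only [smul_zero, sub_zero] at h₅
    refine Eq.trans ?_ h₅
    module
  exact (smul_eq_zero.1 h₄).resolve_left (mul_pos (by linarith) (by linarith)).ne'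

theorem map_one_corner (hΦ : IsScaledStarJordanMap Φ N v) (h : FaithfulSymmIdem e) {m : ℕ}
    (hN : N = 2 ^ m) {α β : ℤ} (hα : 0 ≤ α) (hβ : 0 ≤ β)
    (hv : v = α • (Φ 1 + star (Φ 1)) + β • Φ 1) {a d : A} (ha : IsPeirce e 1 1 a)
    (hd : IsPeirce e 0 0 d) (hu : Φ 1 = a + d) : a = 0 := by
  have hz : ∀ {i j}, IsPeirce e i j 0 := fun {i j} => IsPeirce.zero e i j
  have hp := ((ha.add (ha.star h)).zsmul α).add (ha.zsmul β)
  have hs := ((hd.add (hd.star h)).zsmul α).add (hd.zsmul β)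
  obtain ⟨⟨x, y, z, hx, hy, hz', hA⟩, -⟩ := hΦ.map_idem h ha hz hz hd (by rw [hu]; abel)
    hp hz hz hs (by
      rw [hv, hu]
      simp only [star_add]
      module)
  obtain ⟨⟨x', y', z', hx', hy', hz'', hB⟩, -⟩ := hΦ.map_idem h.compl (a := d) (b := 0) (c := 0)
    (d := a) hd.compl₂₂
    (IsPeirce.zero _ _ _) (IsPeirce.zero _ _ _) ha.compl₁₁
    (by rw [hu]; abel) hs.compl₂₂ (IsPeirce.zero _ _ _)
    (IsPeirce.zero _ _ _) hp.compl₁₁ (by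
      rw [hv, hu]
      simp only [star_add]
      module)
  have hx'' := hx'.compl
  have hy'' := hy'.compl
  have hz''' := hz''.compl
  simp only [sub_sub_cancel, sub_self, sub_zero] at hx'' hy'' hz'''
  have h₁ := hΦ.map_idem_add h
  rw [hu, hA, hB, ← sub_eq_zero] at h₁
  have hxa := (IsPeirce.components_eq_zero (ha.add (hx.zsmul (-1))) ((hy.add hz''').zsmul (-1))
    ((hz'.add hy'').zsmul (-1)) (hd.add (hx''.zsmul (-1))) (by
      refine Eq.trans ?_ h₁
      module)).1
  rw [neg_one_zsmul, ← sub_eq_add_neg, sub_eq_zero] at hxa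
  subst hxa
  set p := α • (a + star a) + β • a with hpdef
  have hcorner : p + star p + N • a = 0 := by
    refine h.eq_zero_of_mul_eq_zero ((hp.add (hp.star h)).add (ha.zsmul N)) fun r hr => ?_
    have h₂ := hΦ.map_zsmul e r
    have hve : starJordan v e = p + star p := by
      have : v = p + (α • (d + star d) + β • d) := by
        rw [hv, hu, hpdef]
        simp only [star_add]
        module
      rw [this, add_starJordan, hp.starJordan_right h, hs.starJordan_right h]
      module
    have hra : ∀ {x}, IsPeirce e 1 1 x → r * x = 0 := fun hx =>
      (hr.mul h hx).eq_zero_of_right h (by norm_num) (by norm_num)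
    obtain ⟨a', b', c', d', ha', hb', hc', hd', hR⟩ := h.exists_decomp (Φ r)
    rw [hr.starJordan_left₁₂ h, hN, hΦ.map_pow_zsmul_offDiagonal h (hr.starJordan_left₁₂ h), ← hN,
      hve, hA, hR] at h₂
    simp only [starJordan_add, ha'.starJordan_left₁₁ h, hb'.starJordan_left₁₂ h,
      hc'.starJordan_left₂₁ h, hd'.starJordan_left₂₂ h] at h₂
    simp only [starJordan, star_add, star_star, mul_add, add_mul, hra hp, hra (hp.star h),
      hra (ha.star h)] at h₂
    have har := ha.mul h hr
    have hyr := hy.mul h hr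
    have hzr := hz'.mul h hr
    have hry := hr.mul h (hy.star h)
    have hrz := hr.mul h (hz'.star h)
    have hpr := (hp.add (hp.star h)).mul h hr
    norm_num at har hyr hzr hry hrz hpr
    rw [eq_comm, ← sub_eq_zero] at h₂
    have h₃ := (IsPeirce.components_eq_zero ((ha'.add hry).zsmul N) (hpr.add (har.zsmul N))
      ((hyr.add hrz).zsmul N) ((hzr.add (hd'.zsmul (-1))).zsmul N) (by
        refine Eq.trans ?_ h₂
        rw [add_mul]
        module)).2.1
    rw [add_mul, smul_mul_assoc, h₃]
  have h₂ := congrArg star hcorner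
  simp only [hpdef, star_add, star_zsmul, star_star, star_zero] at hcorner h₂
  have hsymm : N • (a - star a) = 0 := by
    have h₃ := congrArg₂ (· - ·) hcorner h₂
    simp only [sub_zero] at h₃
    refine Eq.trans ?_ h₃
    module
  rw [← sub_eq_zero.1 (hΦ.cancel hsymm)] at hcorner
  have h₃ : (4 * α + 2 * β + N) • a = 0 := by
    refine Eq.trans ?_ hcorner
    module
  have hNpos : 0 < N := by rw [hN]; positivity
  exact (smul_eq_zero.1 h₃).resolve_left (by linarith : 0 < 4 * α + 2 * β + N).ne'

theorem map_one (hΦ : IsScaledStarJordanMap Φ N v) (h : FaithfulSymmIdem e) {m : ℕ}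
    (hN : N = 2 ^ m) {α β : ℤ} (hα : 0 ≤ α) (hβ : 0 ≤ β) (hβN : β < N)
    (hv : v = α • (Φ 1 + star (Φ 1)) + β • Φ 1) : Φ 1 = 0 := by
  obtain ⟨a, b, c, d, ha, hb, hc, hd, hu⟩ := h.exists_decomp (Φ 1)
  have hb₀ := hΦ.map_one_offDiagonal h hα hβ hβN hv ha hb hc hd hu
  have hc₀ := hΦ.map_one_offDiagonal h.compl hα hβ hβN hv hd.compl₂₂
    hc.compl₂₁ hb.compl₁₂ ha.compl₁₁
    (by rw [hu]; abel)
  rw [hb₀, hc₀, add_zero, add_zero] at hu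
  have ha₀ := hΦ.map_one_corner h hN hα hβ hv ha hd hu
  have hd₀ := hΦ.map_one_corner h.compl hN hα hβ hv hd.compl₂₂
    ha.compl₁₁ (by rw [hu, add_comm])
  rw [hu, ha₀, hd₀, add_zero]

theorem map_two_zsmul (hΦ : IsScaledStarJordanMap Φ N 0) {m : ℕ} (hN : N = 2 ^ m)
    (h1 : Φ 1 = 0) (x : A) : Φ ((2 : ℤ) • x) = (2 : ℤ) • Φ x := by
  have h₁ : ∀ y, Φ ((2 ^ (m + 1) : ℤ) • y) = (2 ^ (m + 1) : ℤ) • Φ y := fun y => by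
    have := hΦ.map_zsmul 1 y
    simp only [one_starJordan, zero_starJordan, h1, zero_add, ← two_zsmul, smul_smul] at this
    rwa [hN, ← pow_succ] at this
  set w := Φ ((2 : ℤ) • (1 : A))
  have h₂ : ∀ y, (2 : ℤ) • Φ ((2 : ℤ) • y) = starJordan w y + (4 : ℤ) • Φ y := fun y => by
    have h₃ := hΦ.map_zsmul ((2 : ℤ) • 1) y
    have h₄ := hΦ.map_zsmul 1 ((2 : ℤ) • y)
    simp only [one_starJordan, zsmul_starJordan, starJordan_zsmul, zero_starJordan, h1] at h₃ h₄
    rw [h₃, ← sub_eq_zero] at h₄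
    rw [← sub_eq_zero, ← neg_eq_zero]
    refine hΦ.cancel (Eq.trans ?_ h₄)
    module
  have h₃ : ∀ k : ℕ, (4 : ℤ) • Φ ((2 ^ k : ℤ) • x) =
      (k * 2 ^ k : ℤ) • starJordan w x + (4 * 2 ^ k : ℤ) • Φ x := by
    intro k
    induction k with
    | zero => simp
    | succ k ih =>
      have h₄ := h₂ ((2 ^ k : ℤ) • x)
      rw [ih, starJordan_zsmul] at h₄
      rw [pow_succ', mul_smul, show (4 : ℤ) = 2 * 2 by norm_num, mul_smul, h₄]
      push_cast
      module
  have h₄ := h₃ (m + 1)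
  rw [h₁, smul_smul, right_eq_add, smul_eq_zero] at h₄
  have h₅ := h₂ x
  rw [h₄.resolve_left (by positivity), zero_add, show (4 : ℤ) = 2 * 2 by norm_num, mul_smul] at h₅
  rw [← sub_eq_zero, ← smul_sub, smul_eq_zero] at h₅
  exact sub_eq_zero.1 (h₅.resolve_left two_ne_zero)

theorem isStarJordanMap (hΦ : IsScaledStarJordanMap Φ N 0) {m : ℕ} (hN : N = 2 ^ m)
    (h1 : Φ 1 = 0) : IsStarJordanMap Φ := by
  have h₁ : ∀ (k : ℕ) x, Φ ((2 ^ k : ℤ) • x) = (2 ^ k : ℤ) • Φ x := by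
    intro k x
    induction k with
    | zero => simp
    | succ k ih => rw [pow_succ', mul_smul, hΦ.map_two_zsmul hN h1, ih, mul_smul]
  intro x y
  have h₂ := hΦ.map_zsmul x y
  rw [hN, h₁, ← hN, zero_starJordan, zero_starJordan, zero_add, ← sub_eq_zero, ← smul_sub] at h₂
  exact sub_eq_zero.1 (hΦ.cancel h₂)

end IsScaledStarJordanMap

end Scaled

section ListProduct

variable {A : Type*} [NonAssocRing A] [StarRing A] {Φ : A → A}

/-- The left-normed `•`-product of a family. -/
def familyProd {n : ℕ} (a : Fin n → A) : A := leftStarJordan (List.ofFn a)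

/-- The sum of the left-normed `•`-products of a family with `Φ` applied to one of the entries. -/
def familyDer (Φ : A → A) {n : ℕ} (a : Fin n → A) : A :=
  ∑ k : Fin n, familyProd (Function.update a k (Φ (a k)))

theorem leftStarJordan_concat {l : List A} (hl : l ≠ []) (x : A) :
    leftStarJordan (l ++ [x]) = starJordan (leftStarJordan l) x := by
  cases l with
  | nil => exact absurd rfl hl
  | cons y l => simp [leftStarJordan]

theorem familyProd_one (a : Fin 1 → A) : familyProd a = a 0 := by
  simp [familyProd, leftStarJordan]

theorem familyDer_one (a : Fin 1 → A) : familyDer Φ a = Φ (a 0) := by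
  simp [familyDer, familyProd_one]

theorem familyProd_snoc {n : ℕ} (a : Fin (n + 1) → A) (x : A) :
    familyProd (Fin.snoc a x : Fin (n + 2) → A) = starJordan (familyProd a) x := by
  rw [familyProd, List.ofFn_succ', List.concat_eq_append, leftStarJordan_concat (by simp)]
  simp [familyProd]

theorem familyDer_snoc {n : ℕ} (a : Fin (n + 1) → A) (x : A) :
    familyDer Φ (Fin.snoc a x : Fin (n + 2) → A) =
      starJordan (familyDer Φ a) x + starJordan (familyProd a) (Φ x) := by
  have hsum : ∀ f : Fin (n + 1) → A, starJordan (∑ k, f k) x = ∑ k, starJordan (f k) x := fun f =>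
    map_sum (AddMonoidHom.mk' (starJordan · x) fun y z => add_starJordan y z x) f _
  rw [familyDer, Fin.sum_univ_castSucc, familyDer, hsum]
  simp only [Fin.snoc_castSucc, Fin.snoc_last, ← Fin.snoc_update, Fin.update_snoc_last,
    familyProd_snoc]

theorem familyProd_const_one (n : ℕ) :
    familyProd (fun _ : Fin (n + 1) => (1 : A)) = (2 ^ n : ℤ) • 1 := by
  induction n with
  | zero => simp [familyProd_one]
  | succ n ih =>
    have : (fun _ => 1 : Fin (n + 2) → A) = Fin.snoc (fun _ : Fin (n + 1) => (1 : A)) 1 := by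
      ext i
      induction i using Fin.lastCases <;> simp
    rw [this, familyProd_snoc, ih, zsmul_starJordan, one_starJordan, pow_succ]
    module

theorem exists_familyDer_const_one (Φ : A → A) (n : ℕ) : ∃ α : ℤ, 0 ≤ α ∧
    familyDer Φ (fun _ : Fin (n + 1) => (1 : A)) =
      α • (Φ 1 + star (Φ 1)) + (2 ^ n : ℤ) • Φ 1 := by
  induction n with
  | zero => exact ⟨0, le_rfl, by simp [familyDer_one]⟩
  | succ n ih =>
    obtain ⟨α, hα, h⟩ := ih
    have : (fun _ => 1 : Fin (n + 2) → A) = Fin.snoc (fun _ : Fin (n + 1) => (1 : A)) 1 := by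
      ext i
      induction i using Fin.lastCases <;> simp
    refine ⟨2 * α + 2 ^ n, by positivity, ?_⟩
    rw [this, familyDer_snoc, h, familyProd_const_one, zsmul_starJordan, one_starJordan,
      starJordan_one]
    simp only [star_add, star_zsmul, star_star]
    module

/-- Specialising all but the last two arguments of a `*`-Jordan `n`-derivation to `1`. -/
theorem exists_isScaledStarJordanMap {m : ℕ}
    (hΦ : ∀ a : Fin (m + 2) → A, Φ (familyProd a) = familyDer Φ a) :
    ∃ α β : ℤ, 0 ≤ α ∧ 0 ≤ β ∧ β < 2 ^ m ∧
      IsScaledStarJordanMap Φ (2 ^ m) (α • (Φ 1 + star (Φ 1)) + β • Φ 1) := by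
  rcases m with _ | m
  · refine ⟨0, 0, le_rfl, le_rfl, by norm_num, by norm_num, fun x y => ?_⟩
    have h := hΦ (Fin.snoc (fun _ : Fin 1 => x) y)
    rw [familyProd_snoc, familyDer_snoc, familyProd_one, familyDer_one] at h
    simpa [zero_starJordan] using h
  · obtain ⟨α, hα, h₁⟩ := exists_familyDer_const_one Φ m
    refine ⟨α, 2 ^ m, hα, by positivity, by rw [pow_succ]; linarith [pow_pos (two_pos (α := ℤ)) m],
      by positivity, fun x y => ?_⟩
    have h := hΦ (Fin.snoc (Fin.snoc (fun _ : Fin (m + 1) => (1 : A)) x) y)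
    rw [familyProd_snoc, familyDer_snoc, familyProd_snoc, familyDer_snoc, h₁,
      familyProd_const_one] at h
    simp only [zsmul_starJordan, one_starJordan, add_starJordan, smul_add] at h
    simp only [zsmul_starJordan, add_starJordan, smul_add, pow_succ, mul_comm _ (2 : ℤ), mul_smul,
      two_zsmul]
    rw [h]
    abel

theorem map_familyProd (hΦ : IsStarJordanMap Φ) {n : ℕ} (a : Fin (n + 1) → A) :
    Φ (familyProd a) = familyDer Φ a := by
  induction n with
  | zero => rw [familyProd_one, familyDer_one]
  | succ n ih =>
    induction a using Fin.snocCases with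
    | snoc a x => rw [familyProd_snoc, familyDer_snoc, hΦ, ih]

end ListProduct

theorem stmt_1 {A : Type*} [NonAssocRing A] [Module ℂ A]
    [SMulCommClass ℂ A A] [IsScalarTower ℂ A A] [StarRing A]
    (halt₁ : ∀ a b : A, a * a * b = a * (a * b))
    (halt₂ : ∀ a b : A, b * a * a = b * (a * a))
    (e : A) (heStar : star e = e) (heIdem : e * e = e) (he0 : e ≠ 0) (he1 : e ≠ 1)
    (hsp : ∀ x : A, (∀ r : A, x * r * e = 0) → x = 0)
    (hcl : ∀ x : A, (∀ r : A, x * r * (1 - e) = 0) → x = 0)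
    (n : ℕ) (hn : 2 ≤ n) (Φ : A → A) :
    (∀ a : Fin n → A,
        Φ (leftStarJordan (List.ofFn a)) =
          ∑ k : Fin n, leftStarJordan (List.ofFn (Function.update a k (Φ (a k))))) ↔
      ((∀ a b : A, Φ (a + b) = Φ a + Φ b) ∧
        (∀ a b : A, Φ (a * b) = Φ a * b + a * Φ b) ∧
        (∀ a : A, Φ (star a) = star (Φ a))) := by
  have : IsAddTorsionFree A := by
    have := Module.IsTorsionFree.trans_faithfulSMul ℤ ℂ A
    exact Module.isTorsionFree_int_iff_isAddTorsionFree.mp this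
  have h : FaithfulSymmIdem e := ⟨halt₁, halt₂, heStar, heIdem, hsp, hcl⟩
  obtain ⟨m, rfl⟩ := Nat.exists_eq_add_of_le' hn
  constructor
  · intro hΦ
    obtain ⟨α, β, hα, hβ, hβN, hscaled⟩ := exists_isScaledStarJordanMap hΦ
    have h1 := hscaled.map_one h rfl hα hβ hβN rfl
    simp only [h1, star_zero, add_zero, smul_zero] at hscaled
    have hmap := hscaled.isStarJordanMap rfl h1
    refine ⟨hmap.map_add h, fun a b => ?_, hmap.map_star h h1⟩
    have h₁ := (hmap.isStarJordanDer h h1).defect_eq_zero h a b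
    rwa [leibnizDefect, sub_sub, sub_eq_zero] at h₁
  · rintro ⟨hadd, hmul, hstar⟩
    refine map_familyProd fun x y => ?_
    simp only [starJordan, hadd, hmul, hstar]
    abel
end

section
/- Let A be a unital alternative *-algebra over ℂ containing a nontrivial symmetric idempotent e satisfying conditions (♠) and (♣), and let Φ : A → A be a map satisfying the *-Jordan n-derivation identity in the last two slots. Then Φ(1) • a = 0 for all a ∈ A, i.e., Φ(1)a + aΦ(1)* = 0 for all a ∈ A. -/
section StarJordan

variable {A : Type*} [NonAssocRing A] [StarRing A]

theorem starJordan_add_left (a b c : A) :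
    starJordan (a + b) c = starJordan a c + starJordan b c := by
  simp only [starJordan, star_add, mul_add, add_mul]; abel

theorem starJordan_add_right (a b c : A) :
    starJordan a (b + c) = starJordan a b + starJordan a c := by
  simp only [starJordan, mul_add, add_mul]; abel

theorem starJordan_sub_left (a b c : A) :
    starJordan (a - b) c = starJordan a c - starJordan b c := by
  simp only [starJordan, star_sub, mul_sub, sub_mul]; abel

theorem starJordan_sub_right (a b c : A) :
    starJordan a (b - c) = starJordan a b - starJordan a c := by
  simp only [starJordan, mul_sub, sub_mul]; abel

theorem starJordan_nsmul_left (k : ℕ) (a b : A) :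
    starJordan (k • a) b = k • starJordan a b := by
  simp only [starJordan, star_nsmul, smul_mul_assoc, mul_smul_comm, smul_add]

theorem starJordan_nsmul_right (k : ℕ) (a b : A) :
    starJordan a (k • b) = k • starJordan a b := by
  simp only [starJordan, smul_mul_assoc, mul_smul_comm, smul_add]

theorem starJordan_zero_left (a : A) : starJordan 0 a = 0 := by simp [starJordan]

theorem starJordan_zero_right (a : A) : starJordan a 0 = 0 := by simp [starJordan]

theorem starJordan_one_left (a : A) : starJordan 1 a = 2 • a := by
  simp only [starJordan, star_one, one_mul, mul_one, two_nsmul]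

theorem starJordan_starJordan_one_one (a : A) :
    starJordan (starJordan a 1) 1 = 2 • starJordan a 1 := by
  simp only [starJordan, mul_one, one_mul, star_add, star_star]; abel

theorem starJordan_sum_left {ι : Type*} (s : Finset ι) (f : ι → A) (a : A) :
    starJordan (∑ i ∈ s, f i) a = ∑ i ∈ s, starJordan (f i) a :=
  map_sum (AddMonoidHom.mk' (fun x => starJordan x a) fun x y => starJordan_add_left x y a) f s

theorem leftStarJordan_ofFn_succ {p : ℕ} (g : Fin (p + 2) → A) :
    leftStarJordan (List.ofFn g) =
      starJordan (leftStarJordan (List.ofFn fun i : Fin (p + 1) => g i.castSucc))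
        (g (Fin.last _)) := by
  rw [List.ofFn_succ', List.concat_eq_append, List.ofFn_succ]
  simp [leftStarJordan]

theorem leftStarJordan_ofFn_const_one (p : ℕ) :
    leftStarJordan (List.ofFn fun _ : Fin (p + 1) => (1 : A)) = 2 ^ p • (1 : A) := by
  induction p with
  | zero => simp [leftStarJordan]
  | succ p ih =>
    rw [leftStarJordan_ofFn_succ, ih, starJordan_nsmul_left, starJordan_one_left, smul_smul,
      pow_succ]

theorem update_castSucc_comp_castSucc {α : Type*} {p : ℕ} (g : Fin (p + 1) → α) (k : Fin p)
    (t : α) :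
    (fun i : Fin p => Function.update g k.castSucc t i.castSucc) =
      Function.update (fun i : Fin p => g i.castSucc) k t := by
  funext i
  by_cases h : i = k
  · subst h; simp
  · rw [Function.update_of_ne h, Function.update_of_ne (by simpa using h)]

theorem update_last_comp_castSucc {α : Type*} {p : ℕ} (g : Fin (p + 1) → α) (t : α) :
    (fun i : Fin p => Function.update g (Fin.last p) t i.castSucc) = fun i => g i.castSucc := by
  funext i
  rw [Function.update_of_ne (Fin.castSucc_lt_last i).ne]

theorem starJordan_leftStarJordan_update_one {p : ℕ} (k : Fin (p + 1)) (t : A) :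
    starJordan (leftStarJordan (List.ofFn (Function.update (fun _ => (1 : A)) k t))) 1 =
      2 ^ p • starJordan t 1 := by
  induction p with
  | zero =>
    obtain rfl : k = 0 := Fin.fin_one_eq_zero k
    simp [leftStarJordan]
  | succ p ih =>
    rw [leftStarJordan_ofFn_succ]
    refine Fin.lastCases ?_ (fun k => ?_) k
    · rw [update_last_comp_castSucc, leftStarJordan_ofFn_const_one, Function.update_self,
        starJordan_nsmul_left, starJordan_one_left, smul_smul, starJordan_nsmul_left, pow_succ]
    · rw [update_castSucc_comp_castSucc, Function.update_of_ne (Fin.castSucc_lt_last k).ne', ih,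
        starJordan_nsmul_left, starJordan_starJordan_one_one, smul_smul, pow_succ]

/-- The identity to which the `*`-Jordan `n`-derivation identity in the last two slots reduces,
with `m = 2 ^ (n - 2)` and `V` collecting the contributions of the leading units. -/
def IsTwistedStarJordanDer (m : ℕ) (V : A) (Φ : A → A) : Prop :=
  ∀ x y : A, Φ (m • starJordan x y) =
    starJordan (starJordan V x) y + m • starJordan (Φ x) y + m • starJordan x (Φ y)

theorem isTwistedStarJordanDer_of_two {Φ : A → A}
    (hΦ : ∀ x y : A,
      Φ (leftStarJordan (List.ofFn (lastTwoFamily 2 x y))) =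
        ∑ k : Fin 2, leftStarJordan (List.ofFn
          (Function.update (lastTwoFamily 2 x y) k (Φ (lastTwoFamily 2 x y k))))) :
    IsTwistedStarJordanDer 1 0 Φ := by
  intro x y
  have h := hΦ x y
  simp [lastTwoFamily, leftStarJordan, Fin.sum_univ_two, List.ofFn_succ, Function.update] at h
  simpa [starJordan_zero_left] using h

theorem isTwistedStarJordanDer_of_add_three {p : ℕ} {Φ : A → A}
    (hΦ : ∀ x y : A,
      Φ (leftStarJordan (List.ofFn (lastTwoFamily (p + 3) x y))) =
        ∑ k : Fin (p + 3), leftStarJordan (List.ofFn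
          (Function.update (lastTwoFamily (p + 3) x y) k (Φ (lastTwoFamily (p + 3) x y k))))) :
    IsTwistedStarJordanDer (2 ^ (p + 1))
      (∑ k : Fin (p + 1),
        leftStarJordan (List.ofFn (Function.update (fun _ => (1 : A)) k (Φ 1)))) Φ := by
  intro x y
  have h1 : ∀ i : Fin (p + 1), lastTwoFamily (p + 3) x y i.castSucc.castSucc = 1 := by
    intro i
    have := i.isLt
    simp only [lastTwoFamily, Fin.val_castSucc]
    rw [if_neg (by omega), if_neg (by omega)]
  have h2 : lastTwoFamily (p + 3) x y (Fin.last (p + 1)).castSucc = x := by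
    simp [lastTwoFamily]
  have h3 : lastTwoFamily (p + 3) x y (Fin.last (p + 2)) = y := by
    simp [lastTwoFamily]
  have h4 : ∀ i : Fin (p + 2), i.castSucc ≠ Fin.last (p + 2) :=
    fun i => (Fin.castSucc_lt_last i).ne
  have h5 : ∀ i : Fin (p + 1), i.castSucc ≠ Fin.last (p + 1) :=
    fun i => (Fin.castSucc_lt_last i).ne
  have h := hΦ x y
  rw [Fin.sum_univ_castSucc, Fin.sum_univ_castSucc] at h
  simp only [leftStarJordan_ofFn_succ, h1, h2, h3, update_castSucc_comp_castSucc,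
    update_last_comp_castSucc, leftStarJordan_ofFn_const_one, Function.update_self,
    Function.update_of_ne (h4 _).symm, Function.update_of_ne (h5 _).symm] at h
  simp only [starJordan_nsmul_left, starJordan_one_left, smul_smul, ← pow_succ] at h
  rw [h, starJordan_sum_left, starJordan_sum_left]

end StarJordan

section Alternative

variable {A : Type*} [NonAssocRing A]

theorem alternative_left_linearized (halt₁ : ∀ a b : A, a * a * b = a * (a * b)) (a b c : A) :
    a * b * c + b * a * c = a * (b * c) + b * (a * c) := by
  have h := halt₁ (a + b) c
  simp only [add_mul, mul_add, halt₁] at h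
  linear_combination (norm := module) h

theorem alternative_right_linearized (halt₂ : ∀ a b : A, b * a * a = b * (a * a)) (a b c : A) :
    a * b * c + a * c * b = a * (b * c) + a * (c * b) := by
  have h := halt₂ (b + c) a
  simp only [add_mul, mul_add, halt₂] at h
  linear_combination (norm := module) h

theorem alternative_flexible (halt₁ : ∀ a b : A, a * a * b = a * (a * b))
    (halt₂ : ∀ a b : A, b * a * a = b * (a * a)) (a b : A) : a * b * a = a * (b * a) := by
  have h := alternative_left_linearized halt₁ a b a
  rw [halt₂] at h
  linear_combination (norm := module) h

variable {e : A}

theorem one_sub_mul_one_sub (heIdem : e * e = e) : (1 - e) * (1 - e) = 1 - e := by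
  simp [mul_sub, sub_mul, heIdem]

variable [IsAddTorsionFree A]

theorem corner_mul_eq_zero (halt₁ : ∀ a b : A, a * a * b = a * (a * b)) (heIdem : e * e = e)
    {t r : A} (het : e * t = t) (hte : t * e = t) (her : e * r = 0) : t * r = 0 := by
  have h := alternative_left_linearized halt₁ t e r
  rw [het, hte, her, mul_zero, zero_add] at h
  have h2 := halt₁ e (t * r)
  rw [heIdem, ← h, mul_add, ← h] at h2
  refine (nsmul_eq_zero_iff_right two_ne_zero).1 (?_ : 2 • (t * r) = 0)
  linear_combination (norm := module) -h2

theorem mul_corner_eq_zero (halt₂ : ∀ a b : A, b * a * a = b * (a * a)) (heIdem : e * e = e)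
    {t r : A} (het : e * t = t) (hte : t * e = t) (hre : r * e = 0) : r * t = 0 := by
  have h := alternative_right_linearized halt₂ r t e
  rw [het, hte, hre, zero_mul, add_zero] at h
  have h2 := halt₂ e (r * t)
  rw [heIdem, h, add_mul, h] at h2
  refine (nsmul_eq_zero_iff_right two_ne_zero).1 (?_ : 2 • (r * t) = 0)
  linear_combination (norm := module) h2

theorem corner_mul_mul_one_sub (halt₁ : ∀ a b : A, a * a * b = a * (a * b))
    (halt₂ : ∀ a b : A, b * a * a = b * (a * a)) (heIdem : e * e = e)
    {t : A} (het : e * t = t) (hte : t * e = t)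
    (hz : ∀ z, e * z = z → z * e = 0 → t * z = 0) (r : A) : t * r * (1 - e) = 0 := by
  have hl : ∀ r, t * (e * r) = t * r := by
    intro r
    have := corner_mul_eq_zero halt₁ heIdem het hte (r := r - e * r)
      (by rw [mul_sub, ← halt₁, heIdem, sub_self])
    rw [mul_sub, sub_eq_zero] at this
    exact this.symm
  have h1 := alternative_right_linearized halt₂ t r e
  rw [hte, hl, add_left_inj] at h1
  have h2 := hz (e * r - e * r * e)
    (by rw [mul_sub, ← alternative_flexible halt₁ halt₂, ← halt₁, heIdem])
    (by rw [sub_mul, halt₂, heIdem, sub_self])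
  rw [mul_sub, sub_eq_zero, alternative_flexible halt₁ halt₂, hl, hl] at h2
  rw [mul_sub, mul_one, h1, h2, sub_self]

end Alternative

section Additivity

variable {A : Type*} [NonAssocRing A] [StarRing A] {m : ℕ} {V : A} {Φ : A → A} {e : A}

theorem starJordan_self_of_star_eq (heStar : star e = e) (t : A) :
    starJordan e t = e * t + t * e := by
  rw [starJordan, heStar]

theorem star_one_sub (heStar : star e = e) : star (1 - e) = 1 - e := by
  rw [star_sub, star_one, heStar]

theorem mul_eq_zero_of_starJordan_eq_zero [IsAddTorsionFree A]
    (halt₁ : ∀ a b : A, a * a * b = a * (a * b))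
    (halt₂ : ∀ a b : A, b * a * a = b * (a * a)) (heIdem : e * e = e) (heStar : star e = e)
    {t : A} (h : starJordan e t = 0) : e * t = 0 ∧ t * e = 0 := by
  rw [starJordan_self_of_star_eq heStar] at h
  have h1 := congrArg (e * ·) h
  have h2 := congrArg (· * e) h
  simp only [mul_add, add_mul, mul_zero, zero_mul, ← halt₁, halt₂, heIdem,
    ← alternative_flexible halt₁ halt₂] at h1 h2
  have h3 : 2 • (e * t) = 0 := by linear_combination (norm := module) h + h1 - h2
  have h4 := (nsmul_eq_zero_iff_right two_ne_zero).1 h3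
  rw [h4, zero_add] at h
  exact ⟨h4, h⟩

namespace IsTwistedStarJordanDer

theorem map_zero (h : IsTwistedStarJordanDer m V Φ) : Φ 0 = 0 := by
  simpa [starJordan_zero_left, starJordan_zero_right] using h 0 0

theorem map_starJordan_add_add (h : IsTwistedStarJordanDer m V Φ) {x y z w : A}
    (hxy : Φ (x + y) = Φ x + Φ y) (hzw : Φ (z + w) = Φ z + Φ w) :
    Φ (m • starJordan (x + y) (z + w)) =
      Φ (m • starJordan x z) + Φ (m • starJordan x w) +
        (Φ (m • starJordan y z) + Φ (m • starJordan y w)) := by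
  rw [h, hxy, hzw, h, h, h, h]
  simp only [starJordan_add_left, starJordan_add_right]
  module

variable [IsAddTorsionFree A]

theorem starJordan_defect_right (h : IsTwistedStarJordanDer m V Φ) (hm : m ≠ 0) {z x y : A}
    (hxy : Φ (m • starJordan z (x + y)) = Φ (m • starJordan z x) + Φ (m • starJordan z y)) :
    starJordan z (Φ (x + y) - (Φ x + Φ y)) = 0 := by
  refine (nsmul_eq_zero_iff_right hm).1 ?_
  rw [h, h, h, starJordan_add_right, starJordan_add_right] at hxy
  rw [starJordan_sub_right, starJordan_add_right]
  linear_combination (norm := module) hxy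

theorem starJordan_defect_left (h : IsTwistedStarJordanDer m V Φ) (hm : m ≠ 0) {z x y : A}
    (hxy : Φ (m • starJordan (x + y) z) = Φ (m • starJordan x z) + Φ (m • starJordan y z)) :
    starJordan (Φ (x + y) - (Φ x + Φ y)) z = 0 := by
  refine (nsmul_eq_zero_iff_right hm).1 ?_
  rw [h, h, h, starJordan_add_right V, starJordan_add_left, starJordan_add_left] at hxy
  rw [starJordan_sub_left, starJordan_add_left]
  linear_combination (norm := module) hxy

theorem starJordan_nsmul_defect_right (h : IsTwistedStarJordanDer m V Φ) (hm : m ≠ 0)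
    {k : ℕ} {z x : A}
    (hx : Φ (m • starJordan z (k • x)) = k • Φ (m • starJordan z x)) :
    starJordan z (Φ (k • x) - k • Φ x) = 0 := by
  refine (nsmul_eq_zero_iff_right hm).1 ?_
  rw [h, h, starJordan_nsmul_right, starJordan_nsmul_right] at hx
  rw [starJordan_sub_right, starJordan_nsmul_right]
  linear_combination (norm := module) hx

theorem starJordan_nsmul_defect_left (h : IsTwistedStarJordanDer m V Φ) (hm : m ≠ 0)
    {k : ℕ} {z x : A}
    (hx : Φ (m • starJordan (k • x) z) = k • Φ (m • starJordan x z)) :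
    starJordan (Φ (k • x) - k • Φ x) z = 0 := by
  refine (nsmul_eq_zero_iff_right hm).1 ?_
  rw [h, h, starJordan_nsmul_right, starJordan_nsmul_left, starJordan_nsmul_left] at hx
  rw [starJordan_sub_left, starJordan_nsmul_left]
  linear_combination (norm := module) hx

theorem map_add_of_diagonal (h : IsTwistedStarJordanDer m V Φ) (hm : m ≠ 0)
    (halt₁ : ∀ a b : A, a * a * b = a * (a * b))
    (halt₂ : ∀ a b : A, b * a * a = b * (a * a)) (heIdem : e * e = e) (heStar : star e = e)
    {x y : A} (hex : e * x = x) (hxe : x * e = x) (hey : e * y = 0) (hye : y * e = 0) :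
    Φ (x + y) = Φ x + Φ y := by
  have h1 := h.starJordan_defect_right hm (z := e) (x := x) (y := y) (by
    have : starJordan e y = 0 := by rw [starJordan_self_of_star_eq heStar, hey, hye, add_zero]
    simp [starJordan_add_right, this, h.map_zero])
  have h2 := h.starJordan_defect_right hm (z := 1 - e) (x := x) (y := y) (by
    have : starJordan (1 - e) x = 0 := by
      rw [starJordan_self_of_star_eq (star_one_sub heStar)]
      simp [sub_mul, mul_sub, hex, hxe]
    simp [starJordan_add_right, this, h.map_zero])
  have h3 := (mul_eq_zero_of_starJordan_eq_zero halt₁ halt₂ heIdem heStar h1).1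
  have h4 := (mul_eq_zero_of_starJordan_eq_zero halt₁ halt₂ (one_sub_mul_one_sub heIdem)
    (star_one_sub heStar) h2).1
  rw [sub_mul, h3, one_mul, sub_zero] at h4
  exact sub_eq_zero.1 h4

theorem map_add_of_offDiagonal (h : IsTwistedStarJordanDer m V Φ) (hm : m ≠ 0)
    (halt₁ : ∀ a b : A, a * a * b = a * (a * b)) (heIdem : e * e = e) (heStar : star e = e)
    {x y : A} (hex : e * x = x) (hxe : x * e = 0) (hey : e * y = 0) (hye : y * e = y) :
    Φ (x + y) = Φ x + Φ y := by
  have hsx : e * star x = 0 := by simpa [heStar] using congrArg star hxe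
  have hsy : e * star y = star y := by simpa [heStar] using congrArg star hye
  have hz : star (e - (1 - e)) = e - (1 - e) := by rw [star_sub, star_one_sub heStar, heStar]
  have h1 := h.starJordan_defect_right hm (z := e - (1 - e)) (x := x) (y := y) (by
    have hx : starJordan (e - (1 - e)) x = 0 := by
      rw [starJordan_self_of_star_eq hz]; simp [sub_mul, mul_sub, hex, hxe]
    have hy : starJordan (e - (1 - e)) y = 0 := by
      rw [starJordan_self_of_star_eq hz]; simp [sub_mul, mul_sub, hey, hye]
    simp [starJordan_add_right, hx, hy, h.map_zero])
  have h2 := h.starJordan_defect_left hm (z := e) (x := x) (y := y) (by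
    have : starJordan x e = 0 := by simp [starJordan, hxe, hsx]
    simp [starJordan_add_left, this, h.map_zero])
  have h3 := h.starJordan_defect_left hm (z := 1 - e) (x := x) (y := y) (by
    have : starJordan y (1 - e) = 0 := by simp [starJordan, mul_sub, sub_mul, hye, hsy]
    simp [starJordan_add_left, this, h.map_zero])
  rw [starJordan_self_of_star_eq hz] at h1
  refine sub_eq_zero.1 ?_
  generalize Φ (x + y) - (Φ x + Φ y) = t at *
  simp only [starJordan, mul_sub, sub_mul, mul_one, one_mul] at h1 h2 h3
  have h4 : star t = -t := by linear_combination (norm := module) h2 + h3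
  rw [h4, mul_neg] at h2
  have h5 : t * e = e * t := by linear_combination (norm := module) h2
  rw [h5] at h1
  have h6 : 2 • t = 2 • (2 • (e * t)) := by linear_combination (norm := module) -h1
  have h7 : t = 2 • (e * t) := nsmul_right_injective two_ne_zero h6
  have h8 := congrArg (e * ·) h7
  simp only [mul_smul_comm, ← halt₁, heIdem] at h8
  have h9 : e * t = 0 := by linear_combination (norm := module) -h8
  rw [h7, h9, smul_zero]

theorem map_add_of_corner_of_offDiagonal (h : IsTwistedStarJordanDer m V Φ) (hm : m ≠ 0)
    (halt₁ : ∀ a b : A, a * a * b = a * (a * b))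
    (halt₂ : ∀ a b : A, b * a * a = b * (a * a)) (heIdem : e * e = e) (heStar : star e = e)
    {x w : A} (hex : e * x = x) (hxe : x * e = x) (hw : e * w + w * e = w) :
    Φ (x + w) = Φ x + Φ w := by
  have hz : star (e - (1 - e)) = e - (1 - e) := by rw [star_sub, star_one_sub heStar, heStar]
  have h1 := h.starJordan_defect_right hm (z := 1 - e) (x := x) (y := w) (by
    have : starJordan (1 - e) x = 0 := by
      rw [starJordan_self_of_star_eq (star_one_sub heStar)]
      simp [sub_mul, mul_sub, hex, hxe]
    simp [starJordan_add_right, this, h.map_zero])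
  have h2 := h.starJordan_defect_right hm (z := e - (1 - e)) (x := x) (y := w) (by
    have : starJordan (e - (1 - e)) w = 0 := by
      rw [starJordan_self_of_star_eq hz]
      simp only [sub_mul, mul_sub, one_mul, mul_one]
      linear_combination (norm := module) 2 • hw
    simp [starJordan_add_right, this, h.map_zero])
  have h3 := mul_eq_zero_of_starJordan_eq_zero halt₁ halt₂ (one_sub_mul_one_sub heIdem)
    (star_one_sub heStar) h1
  rw [starJordan_self_of_star_eq hz] at h2
  refine sub_eq_zero.1 ?_
  generalize Φ (x + w) - (Φ x + Φ w) = t at *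
  rw [sub_mul, mul_sub, h3.1, h3.2] at h2
  simp only [mul_sub, sub_mul, mul_one, one_mul] at h3
  refine (nsmul_eq_zero_iff_right two_ne_zero).1 (?_ : 2 • t = 0)
  linear_combination (norm := module) h2 + h3.1 + h3.2

theorem map_nsmul_of_offDiagonal (h : IsTwistedStarJordanDer m V Φ) (hm : m ≠ 0)
    (halt₁ : ∀ a b : A, a * a * b = a * (a * b))
    (halt₂ : ∀ a b : A, b * a * a = b * (a * a)) (heIdem : e * e = e) (heStar : star e = e)
    {a : A} (hea : e * a = a) (hae : a * e = 0) (k : ℕ) :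
    Φ (m • k • a) = k • Φ (m • a) := by
  induction k with
  | zero => simp [h.map_zero]
  | succ k ih =>
    have hsa : e * star a = 0 := by simpa [heStar] using congrArg star hae
    have hse : star a * e = star a := by simpa [heStar] using congrArg star hea
    have haa : a * a = 0 := by
      have := alternative_flexible halt₁ halt₂ a e
      rwa [hae, hea, zero_mul, eq_comm] at this
    have hl : e * (a * star a) = a * star a := by
      have := alternative_left_linearized halt₁ a e (star a)
      simpa [hae, hea, hsa] using this.symm
    have hr : a * star a * e = a * star a := by
      have := alternative_right_linearized halt₂ a (star a) e
      simpa [hae, hse, hsa] using this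
    have h1 : Φ (e + a) = Φ e + Φ a :=
      h.map_add_of_corner_of_offDiagonal hm halt₁ halt₂ heIdem heStar heIdem heIdem
        (by rw [hea, hae, add_zero])
    have h2 : Φ ((1 - e) + k • a) = Φ (1 - e) + Φ (k • a) :=
      h.map_add_of_corner_of_offDiagonal hm halt₁ halt₂ (one_sub_mul_one_sub heIdem)
        (star_one_sub heStar) (one_sub_mul_one_sub heIdem) (one_sub_mul_one_sub heIdem)
        (by simp [mul_sub, sub_mul, mul_smul_comm, smul_mul_assoc, hea, hae, -nsmul_eq_mul])
    have h3 := h.map_starJordan_add_add h1 h2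
    have e1 : starJordan e (1 - e) = 0 := by simp [starJordan, heStar, mul_sub, sub_mul, heIdem]
    have e2 : starJordan e (k • a) = k • a := by
      rw [starJordan_nsmul_right, starJordan, heStar, hea, hae, add_zero]
    have e3 : starJordan a (1 - e) = a + star a := by
      simp [starJordan, mul_sub, sub_mul, hae, hsa]
    have e4 : starJordan a (k • a) = k • (a * star a) := by
      rw [starJordan_nsmul_right, starJordan, haa, zero_add]
    have e5 : m • starJordan (e + a) (1 - e + k • a) =
        m • k • (a * star a) + (m • (k + 1) • a + m • star a) := by
      rw [starJordan_add_left, starJordan_add_right, starJordan_add_right, e1, e2, e3, e4]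
      module
    rw [e5, e1, e2, e3, e4, smul_zero, h.map_zero, smul_add,
      h.map_add_of_corner_of_offDiagonal hm halt₁ halt₂ heIdem heStar
        (by simp only [mul_smul_comm, hl]) (by simp only [smul_mul_assoc, hr])
        (by simp only [mul_add, add_mul, mul_smul_comm, smul_mul_assoc, hea, hae, hsa, hse]
            module),
      h.map_add_of_offDiagonal hm halt₁ heIdem heStar
        (by simp only [mul_smul_comm, hea]) (by simp only [smul_mul_assoc, hae, smul_zero])
        (by simp only [mul_smul_comm, hsa, smul_zero]) (by simp only [smul_mul_assoc, hse]),
      h.map_add_of_offDiagonal hm halt₁ heIdem heStar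
        (by simp only [mul_smul_comm, hea]) (by simp only [smul_mul_assoc, hae, smul_zero])
        (by simp only [mul_smul_comm, hsa, smul_zero]) (by simp only [smul_mul_assoc, hse]),
      ih] at h3
    linear_combination (norm := module) h3

theorem map_nsmul_idempotent (h : IsTwistedStarJordanDer m V Φ) (hm : m ≠ 0)
    (halt₁ : ∀ a b : A, a * a * b = a * (a * b))
    (halt₂ : ∀ a b : A, b * a * a = b * (a * a)) (heIdem : e * e = e) (heStar : star e = e)
    (hcl : ∀ x : A, (∀ r : A, x * r * (1 - e) = 0) → x = 0) (k : ℕ) :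
    Φ (k • e) = k • Φ e := by
  have h1 := h.starJordan_nsmul_defect_right hm (k := k) (z := 1 - e) (x := e) (by
    have : starJordan (1 - e) e = 0 := by
      rw [starJordan_self_of_star_eq (star_one_sub heStar)]
      simp [sub_mul, mul_sub, heIdem]
    simp only [starJordan_nsmul_right, this, h.map_zero, smul_zero])
  have h2 : ∀ z, e * z = z → z * e = 0 → starJordan (Φ (k • e) - k • Φ e) z = 0 := by
    intro z hez hze
    refine h.starJordan_nsmul_defect_left hm ?_
    rw [starJordan_nsmul_left, starJordan, heStar, hez, hze, add_zero]
    exact h.map_nsmul_of_offDiagonal hm halt₁ halt₂ heIdem heStar hez hze k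
  have h3 := mul_eq_zero_of_starJordan_eq_zero halt₁ halt₂ (one_sub_mul_one_sub heIdem)
    (star_one_sub heStar) h1
  refine sub_eq_zero.1 (hcl _ ?_)
  generalize Φ (k • e) - k • Φ e = t at *
  rw [sub_mul, mul_sub, one_mul, mul_one, sub_eq_zero, sub_eq_zero] at h3
  have het := h3.1.symm
  have hte := h3.2.symm
  refine corner_mul_mul_one_sub halt₁ halt₂ heIdem het hte fun z hez hze => ?_
  have h4 := h2 z hez hze
  rwa [starJordan, mul_corner_eq_zero halt₂ heIdem (t := star t)
    (by simpa [heStar] using congrArg star hte) (by simpa [heStar] using congrArg star het) hze,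
    add_zero] at h4

theorem map_nsmul_one (h : IsTwistedStarJordanDer m V Φ) (hm : m ≠ 0)
    (halt₁ : ∀ a b : A, a * a * b = a * (a * b))
    (halt₂ : ∀ a b : A, b * a * a = b * (a * a)) (heIdem : e * e = e) (heStar : star e = e)
    (hsp : ∀ x : A, (∀ r : A, x * r * e = 0) → x = 0)
    (hcl : ∀ x : A, (∀ r : A, x * r * (1 - e) = 0) → x = 0) (k : ℕ) :
    Φ (k • (1 : A)) = k • Φ 1 := by
  have h1 : ∀ j : ℕ, Φ (j • e + j • (1 - e)) = Φ (j • e) + Φ (j • (1 - e)) := fun j =>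
    h.map_add_of_diagonal hm halt₁ halt₂ heIdem heStar
      (by simp only [mul_smul_comm, heIdem]) (by simp only [smul_mul_assoc, heIdem])
      (by rw [mul_smul_comm, mul_sub, mul_one, heIdem, sub_self, smul_zero])
      (by rw [smul_mul_assoc, sub_mul, one_mul, heIdem, sub_self, smul_zero])
  have h2 := h1 1
  have h3 := h1 k
  rw [← smul_add, add_sub_cancel] at h2 h3
  simp only [one_smul] at h2
  rw [h3, h2, h.map_nsmul_idempotent hm halt₁ halt₂ heIdem heStar hcl,
    h.map_nsmul_idempotent hm halt₁ halt₂ (one_sub_mul_one_sub heIdem) (star_one_sub heStar)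
      (by simpa using hsp), smul_add]

theorem starJordan_map_one_eq_zero (h : IsTwistedStarJordanDer m V Φ) (hm : m ≠ 0)
    (hone : ∀ k : ℕ, Φ (k • (1 : A)) = k • Φ 1) {c : ℕ}
    (hV : 2 • starJordan V 1 = c • starJordan (Φ 1) 1) (y : A) : starJordan (Φ 1) y = 0 := by
  have hS : starJordan (Φ 1) 1 = 0 := by
    have h1 := h 1 1
    rw [starJordan_starJordan_one_one, hV, starJordan_one_left, starJordan_one_left, smul_smul,
      hone] at h1
    refine (nsmul_eq_zero_iff_right (by omega : c + m ≠ 0)).1 ?_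
    linear_combination (norm := module) -h1
  have hU : starJordan V 1 = 0 := by
    rw [hS, smul_zero] at hV
    exact (nsmul_eq_zero_iff_right two_ne_zero).1 hV
  have h1 : ∀ k : ℕ, ∀ y, Φ (m • k • 2 • y) = m • k • starJordan (Φ 1) y + m • k • 2 • Φ y := by
    intro k y
    have := h (k • 1) y
    simpa only [starJordan_nsmul_left, starJordan_nsmul_right, hU, starJordan_zero_left,
      starJordan_one_left, hone, smul_zero, zero_add] using this
  have h2 := h1 (m * 2) y
  have h3 := h1 1 (m • 1 • 2 • y)
  rw [h1 1 y] at h3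
  have h4 : m • 1 • 2 • m • 1 • 2 • y = m • (m * 2) • 2 • y := by module
  rw [h4, h2] at h3
  simp only [starJordan_nsmul_right] at h3
  refine (nsmul_eq_zero_iff_right (by positivity : m * m * 2 ≠ 0)).1 ?_
  linear_combination (norm := module) -h3

end IsTwistedStarJordanDer

end Additivity

theorem stmt_10 {A : Type*} [NonAssocRing A] [Module ℂ A]
    [SMulCommClass ℂ A A] [IsScalarTower ℂ A A] [StarRing A]
    (halt₁ : ∀ a b : A, a * a * b = a * (a * b))
    (halt₂ : ∀ a b : A, b * a * a = b * (a * a))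
    (e : A) (heStar : star e = e) (heIdem : e * e = e) (he0 : e ≠ 0) (he1 : e ≠ 1)
    (hsp : ∀ x : A, (∀ r : A, x * r * e = 0) → x = 0)
    (hcl : ∀ x : A, (∀ r : A, x * r * (1 - e) = 0) → x = 0)
    (n : ℕ) (hn : 2 ≤ n) (Φ : A → A)
    (hΦ : ∀ x y : A,
      Φ (leftStarJordan (List.ofFn (lastTwoFamily n x y))) =
        ∑ k : Fin n, leftStarJordan (List.ofFn
          (Function.update (lastTwoFamily n x y) k (Φ (lastTwoFamily n x y k))))) :
    ∀ a : A, starJordan (Φ 1) a = 0 := by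
  have : IsAddTorsionFree A := by
    have : Module ℚ A := Module.compHom A (algebraMap ℚ ℂ)
    exact .of_module_rat A
  match n, hn with
  | 2, _ =>
    have h := isTwistedStarJordanDer_of_two hΦ
    exact h.starJordan_map_one_eq_zero one_ne_zero
      (h.map_nsmul_one one_ne_zero halt₁ halt₂ heIdem heStar hsp hcl) (c := 0)
      (by simp [starJordan_zero_left])
  | p + 3, _ =>
    have h := isTwistedStarJordanDer_of_add_three hΦ
    have hm : 2 ^ (p + 1) ≠ 0 := by positivity
    exact h.starJordan_map_one_eq_zero hm
      (h.map_nsmul_one hm halt₁ halt₂ heIdem heStar hsp hcl) (c := 2 * ((p + 1) * 2 ^ p))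
      (by simp only [starJordan_sum_left, starJordan_leftStarJordan_update_one,
            Finset.sum_const, Finset.card_univ, Fintype.card_fin, smul_smul])
end
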